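/- arXiv:2207.08418 — 2 statements merged into one kernel-verified Lean document; each statement's English description precedes it below -/
import Mathlib

section
/- Fix an integer k ≥ 1, and let NC₂(2k) be the set of fixed-point-free involutions π of {1,…,2k} that are noncrossing, i.e., there are no a < b < c < d with π(a) = c and π(b) = d. For π, τ ∈ NC₂(2k) let loops(π,τ) be the number of orbits on {1,…,2k} of the subgroup generated by π and τ, and for a real number x let G(x) be the square matrix indexed by NC₂(2k) with entries G(x)_{π,τ} = x^{loops(π,τ)}. Then for every real x ≥ 2 the matrix G(x) is invertible, every entry of G(x)⁻¹ is nonzero, and each entry of G(x)⁻¹, viewed as a function of x, is monotone on the interval [2, ∞). -/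
open scoped Classical

/-- The predicate describing a noncrossing pair partition of `{1,…,2k}`, encoded as a
noncrossing fixed-point-free involution. -/
def IsNCPairing {m : ℕ} (π : Equiv.Perm (Fin m)) : Prop :=
  (∀ t, π (π t) = t) ∧ (∀ t, π t ≠ t) ∧
    ¬∃ a b c d : Fin m, a < b ∧ b < c ∧ c < d ∧ π a = c ∧ π b = d

/-- `loops π τ`: the number of orbits on `{1,…,m}` of the subgroup generated by `π, τ`. -/
noncomputable def loops {m : ℕ} (π τ : Equiv.Perm (Fin m)) : ℕ :=
  Nat.card (MulAction.orbitRel.Quotient (↥(Subgroup.closure {π, τ})) (Fin m))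

/-- The Gram matrix of the Temperley–Lieb diagrams, indexed by noncrossing pair
partitions `NC₂(2k)`, with entries `x^{loops(π,τ)}`. -/
noncomputable def tlGram (k : ℕ) (x : ℝ) :
    Matrix {π : Equiv.Perm (Fin (2 * k)) // IsNCPairing π}
      {π : Equiv.Perm (Fin (2 * k)) // IsNCPairing π} ℝ :=
  fun π τ => x ^ loops (π : Equiv.Perm (Fin (2 * k))) (τ : Equiv.Perm (Fin (2 * k)))

/-- A noncrossing pairing of `{0, …, n - 1}`, as an involution of `ℕ` fixing exactly the
numbers `≥ n`. -/
@[ext]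
structure NCPairing (n : ℕ) where
  /-- The partner of a point. -/
  f : ℕ → ℕ
  f_lt : ∀ t, t < n → f t < n
  f_out : ∀ t, n ≤ t → f t = t
  f_f : ∀ t, f (f t) = t
  f_ne : ∀ t, t < n → f t ≠ t
  nc : ∀ a b, a < b → b < f a → a < f b ∧ f b < f a

namespace NCPairing

/-- The increasing enumeration of the complement of `{i, i + 1}`. -/
def skip (i t : ℕ) : ℕ := if t < i then t else t + 2

/-- The left inverse of `skip i`. -/
def unskip (i t : ℕ) : ℕ := if t < i then t else t - 2

/-- Insert a new pair at the adjacent positions `i, i + 1`. -/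
def ins {n : ℕ} (i : ℕ) (hi : i ≤ n) (σ : NCPairing n) : NCPairing (n + 2) where
  f t := if t = i then i + 1 else if t = i + 1 then i else skip i (σ.f (unskip i t))
  f_lt t ht := by
    have h1 := σ.f_lt (unskip i t)
    grind (splits := 30) [skip, unskip]
  f_out t ht := by
    have h1 := σ.f_out (unskip i t)
    grind (splits := 30) [skip, unskip]
  f_f t := by
    have h1 := σ.f_f (unskip i t)
    grind (splits := 30) [skip, unskip]
  f_ne t ht := by
    have h1 := σ.f_ne (unskip i t)
    grind (splits := 30) [skip, unskip]
  nc a b hab hb := by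
    have h1 := σ.nc (unskip i a) (unskip i b)
    have h2 := σ.f_ne (unskip i a)
    have h3 := σ.f_out (unskip i a)
    grind (splits := 30) [skip, unskip]

/-- Close up the adjacent positions `i, i + 1`, joining their partners. -/
def cap {n : ℕ} (i : ℕ) (hi : i ≤ n) (p : NCPairing (n + 2)) : NCPairing n where
  f t := if p.f (skip i t) = i then unskip i (p.f (i + 1))
    else if p.f (skip i t) = i + 1 then unskip i (p.f i) else unskip i (p.f (skip i t))
  f_lt t ht := by
    have h1 := p.f_lt (skip i t)
    have h2 := p.f_lt i
    have h3 := p.f_lt (i + 1)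
    have h4 := p.f_f (skip i t)
    have h5 := p.f_f i
    have h6 := p.f_f (i + 1)
    have h7 := p.f_ne i
    have h8 := p.f_ne (i + 1)
    grind (splits := 30) [skip, unskip]
  f_out t ht := by
    have h1 := p.f_out (skip i t)
    grind (splits := 30) [skip, unskip]
  f_f t := by
    have h4 := p.f_f (skip i t)
    have h5 := p.f_f i
    have h6 := p.f_f (i + 1)
    have h7 := p.f_ne i
    have h8 := p.f_ne (i + 1)
    grind (splits := 30) [skip, unskip]
  f_ne t ht := by
    have h4 := p.f_f (skip i t)
    have h5 := p.f_f i
    have h6 := p.f_f (i + 1)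
    have h7 := p.f_ne i
    have h8 := p.f_ne (i + 1)
    have h9 := p.f_ne (skip i t)
    grind (splits := 30) [skip, unskip]
  nc a b hab hb := by
    have hA : skip i a ≠ i ∧ skip i a ≠ i + 1 := by grind [skip]
    have hB : skip i b ≠ i ∧ skip i b ≠ i + 1 := by grind [skip]
    have hu : ∀ t, unskip i (skip i t) = t := by grind [skip, unskip]
    have hs : ∀ t, t ≠ i → t ≠ i + 1 → skip i (unskip i t) = t := by grind [skip, unskip]
    have hlt : ∀ s t, skip i s < skip i t ↔ s < t := by grind [skip]
    have hfA := p.f_f (skip i a)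
    have hfB := p.f_f (skip i b)
    have hi0 := p.f_f i
    have hi1 := p.f_f (i + 1)
    have hn0 := p.f_ne i
    have hn1 := p.f_ne (i + 1)
    rw [← hlt] at hab hb
    rw [← hlt, ← hlt]
    have h1 := p.nc (skip i a) (skip i b)
    by_cases hAi : p.f (skip i a) = i
    · have h2 := p.nc (i + 1) (skip i a)
      have h3 := p.nc (i + 1) (skip i b)
      have h4 := p.nc (skip i a) (p.f (i + 1))
      grind
    by_cases hAi' : p.f (skip i a) = i + 1
    · have h2 := p.nc (skip i a) i
      have h3 := p.nc (p.f i) (p.f (skip i b))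
      have h4 := p.nc i (skip i b)
      have h5 := p.nc (i + 1) (p.f (skip i b))
      have h6 := p.nc i (skip i a)
      grind
    have h2 := p.nc (skip i a) i
    have h3 := p.nc (skip i a) (i + 1)
    grind

variable {n : ℕ}

theorem cap_ins_self (i : ℕ) (hi : i ≤ n) (σ : NCPairing n) : cap i hi (ins i hi σ) = σ := by
  ext t
  simp only [cap, ins]
  grind (splits := 30) [skip, unskip]

theorem cap_ins_succ (i : ℕ) (hi : i + 1 ≤ n) (σ : NCPairing n) :
    cap i (by omega) (ins (i + 1) hi σ) = σ := by
  ext t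
  have h1 := σ.f_f t
  have h2 := σ.f_f i
  have h3 := σ.f_ne t
  have h4 := σ.f_out t
  simp only [cap, ins]
  grind (splits := 30) [skip, unskip]

theorem cap_succ_ins (i : ℕ) (hi : i + 1 ≤ n) (σ : NCPairing n) :
    cap (i + 1) hi (ins i (by omega) σ) = σ := by
  ext t
  have h1 := σ.f_f t
  have h2 := σ.f_f i
  have h3 := σ.f_ne t
  have h4 := σ.f_out t
  simp only [cap, ins]
  grind (splits := 30) [skip, unskip]

theorem cap_ins_of_le (i m : ℕ) (him : i ≤ m) (hm : m ≤ n) (σ : NCPairing (n + 2)) :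
    cap i (by omega) (ins (m + 2) (by omega) σ) = ins m hm (cap i (by omega) σ) := by
  ext t
  have h1 : t ≠ m → t ≠ m + 1 → unskip (m + 2) (skip i t) = skip i (unskip m t) := by
    grind [skip, unskip]
  have h2 : ∀ s, s ≠ i → s ≠ i + 1 → unskip i (skip (m + 2) s) = skip m (unskip i s) := by
    grind [skip, unskip]
  have h3 : ∀ s, (skip (m + 2) s = i ↔ s = i) ∧ (skip (m + 2) s = i + 1 ↔ s = i + 1) := by
    grind [skip]
  have h4 : unskip (m + 2) i = i ∧ unskip (m + 2) (i + 1) = i + 1 := by grind [unskip]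
  have h5 := σ.f_f (skip i (unskip m t))
  have h7 := σ.f_f i
  have h8 := σ.f_ne i
  have h9 := σ.f_ne (i + 1)
  have h6 : (skip i t = m + 2 ↔ t = m) ∧ (skip i t = m + 3 ↔ t = m + 1) := by grind [skip]
  have ha : m + 3 ≠ i ∧ m + 2 ≠ i ∧ m + 3 ≠ i + 1 ∧ m + 2 ≠ i + 1 ∧ i ≠ m + 2 ∧ i ≠ m + 3 ∧
    i + 1 ≠ m + 2 ∧ i + 1 ≠ m + 3 ∧ unskip i (m + 3) = m + 1 ∧ unskip i (m + 2) = m ∧ m + 1 ≠ m := by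
    grind [unskip]
  simp only [cap, ins, h6, h4, ha, if_false]
  by_cases ht : t = m
  · simp [ht, ha]
  by_cases ht' : t = m + 1
  · simp [ht', ha]
  have h10 : ∀ s, skip i s ≠ i ∧ skip i s ≠ i + 1 := by grind [skip]
  have h11 := h10 (unskip m t)
  have h12 := σ.f_f (i + 1)
  simp only [ht, ht', if_false, h1 ht ht', h3]
  split_ifs with ha hb
  · exact h2 _ (by grind) (by grind)
  · exact h2 _ (by grind) (by grind)
  · exact h2 _ ha hb

theorem cap_ins_of_ge (i m : ℕ) (him : m ≤ i) (hi : i ≤ n) (σ : NCPairing (n + 2)) :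
    cap (i + 2) (by omega) (ins m (by omega) σ) = ins m (by omega) (cap i hi σ) := by
  ext t
  have h1 : t ≠ m → t ≠ m + 1 → unskip m (skip (i + 2) t) = skip i (unskip m t) := by
    grind [skip, unskip]
  have h2 : ∀ s, s ≠ i → s ≠ i + 1 → unskip (i + 2) (skip m s) = skip m (unskip i s) := by
    grind [skip, unskip]
  have h3 : ∀ s, (skip m s = i + 2 ↔ s = i) ∧ (skip m s = i + 3 ↔ s = i + 1) := by
    grind [skip]
  have h4 : unskip m (i + 2) = i ∧ unskip m (i + 3) = i + 1 := by grind [unskip]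
  have h5 := σ.f_f (skip i (unskip m t))
  have h7 := σ.f_f i
  have h8 := σ.f_ne i
  have h9 := σ.f_ne (i + 1)
  have h6 : (skip (i + 2) t = m ↔ t = m) ∧ (skip (i + 2) t = m + 1 ↔ t = m + 1) := by
    grind [skip]
  have ha : m + 1 ≠ i + 2 ∧ m ≠ i + 2 ∧ m + 1 ≠ i + 3 ∧ m ≠ i + 3 ∧ i + 2 ≠ m ∧ i + 2 ≠ m + 1 ∧
    i + 3 ≠ m ∧ i + 3 ≠ m + 1 ∧ unskip (i + 2) (m + 1) = m + 1 ∧ unskip (i + 2) m = m ∧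
    m + 1 ≠ m := by
    grind [unskip]
  simp only [cap, ins, h6, h4, ha, if_false]
  by_cases ht : t = m
  · simp [ht, ha]
    omega
  by_cases ht' : t = m + 1
  · simp [ht', ha]
  have h10 : ∀ s, skip i s ≠ i ∧ skip i s ≠ i + 1 := by grind [skip]
  have h11 := h10 (unskip m t)
  have h12 := σ.f_f (i + 1)
  simp only [ht, ht', if_false, h1 ht ht', h3]
  split_ifs with ha hb
  · exact h2 _ (by grind) (by grind)
  · exact h2 _ (by grind) (by grind)
  · exact h2 _ ha hb

theorem ins_ins (i m : ℕ) (him : i ≤ m) (hm : m ≤ n) (ρ : NCPairing n) :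
    ins (m + 2) (by omega) (ins i (by omega) ρ) = ins i (by omega) (ins m hm ρ) := by
  ext t
  simp only [ins]
  grind (splits := 30) [skip, unskip]

theorem ins_cap {i : ℕ} (hi : i ≤ n) (p : NCPairing (n + 2)) (h : p.f i = i + 1) :
    ins i hi (cap i hi p) = p := by
  ext t
  have h1 := p.f_f i
  have h2 := p.f_f t
  have h3 : t ≠ i → t ≠ i + 1 → skip i (unskip i t) = t := by grind [skip, unskip]
  have h4 : ∀ t, t ≠ i → t ≠ i + 1 → skip i (unskip i t) = t := by grind [skip, unskip]
  simp only [cap, ins]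
  grind

theorem exists_f_eq_succ (p : NCPairing n) (d t : ℕ) (ht : t < p.f t) (hd : p.f t ≤ t + d) :
    ∃ i, p.f i = i + 1 := by
  induction d generalizing t with
  | zero => omega
  | succ d ih =>
    by_cases h : p.f t = t + 1
    · exact ⟨t, h⟩
    · have h1 := p.nc t (t + 1) (by omega) (by omega)
      have h2 := p.f_ne (t + 1)
      have h3 := p.f_out t
      have h4 := p.f_out (p.f t)
      have h5 := p.f_f t
      exact ih (t + 1) (by omega) (by omega)

theorem exists_ins (p : NCPairing (n + 2)) : ∃ i, ∃ hi : i ≤ n, ∃ σ, p = ins i hi σ := by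
  have h0 := p.f_ne 0 (by omega)
  obtain ⟨i, hi⟩ := exists_f_eq_succ p (p.f 0) 0 (by omega) (by omega)
  have h1 := p.f_out (i + 1)
  have h2 := p.f_out i
  have h3 := p.f_f i
  have hin : i ≤ n := by grind
  exact ⟨i, hin, cap i hin p, (ins_cap hin p hi).symm⟩

theorem ins_f_skip {i : ℕ} (hi : i ≤ n) (σ : NCPairing n) (t : ℕ) :
    (ins i hi σ).f (skip i t) = skip i (σ.f t) := by
  simp only [ins]
  grind [skip, unskip]

/-- The permutation of `Fin n` underlying a noncrossing pairing. -/
def toPerm (p : NCPairing n) : Equiv.Perm (Fin n) where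
  toFun t := ⟨p.f t, p.f_lt t t.2⟩
  invFun t := ⟨p.f t, p.f_lt t t.2⟩
  left_inv t := by simp [p.f_f]
  right_inv t := by simp [p.f_f]

@[simp]
theorem toPerm_val (p : NCPairing n) (t : Fin n) : (p.toPerm t : ℕ) = p.f t := rfl

theorem isNCPairing_toPerm (p : NCPairing n) : IsNCPairing p.toPerm := by
  refine ⟨fun t => Fin.ext (p.f_f t), fun t h => p.f_ne t t.2 (congrArg Fin.val h), ?_⟩
  rintro ⟨a, b, c, d, hab, hbc, hcd, h1, h2⟩
  have h1 := congrArg Fin.val h1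
  have h2 := congrArg Fin.val h2
  have h3 := p.nc a b
  simp only [toPerm_val, Fin.lt_def] at *
  omega

/-- The noncrossing pairing given by a permutation of `Fin n`. -/
def ofPerm (π : Equiv.Perm (Fin n)) (hπ : IsNCPairing π) : NCPairing n where
  f t := if h : t < n then π ⟨t, h⟩ else t
  f_lt t ht := by simp [ht]
  f_out t ht := by simp [ht]
  f_f t := by
    by_cases h : t < n
    · simp [h, hπ.1]
    · simp [h]
  f_ne t ht h := hπ.2.1 ⟨t, ht⟩ (Fin.ext (by simpa [ht] using h))
  nc a b hab hb := by
    by_cases ha : a < n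
    · simp only [ha, dif_pos] at hb ⊢
      have hbn : b < n := by omega
      simp only [hbn, dif_pos]
      have hne : π ⟨b, hbn⟩ ≠ ⟨a, ha⟩ := fun h => by
        have := hπ.1 ⟨b, hbn⟩
        rw [h] at this
        have := congrArg Fin.val this
        simp only at this
        omega
      have hne' : π ⟨b, hbn⟩ ≠ π ⟨a, ha⟩ := fun h => by
        have := congrArg Fin.val (π.injective h)
        simp only at this
        omega
      rw [Ne, Fin.ext_iff] at hne hne'
      simp only at hne
      by_contra hcon
      by_cases hlt : (π ⟨b, hbn⟩ : ℕ) < a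
      · exact hπ.2.2 ⟨π ⟨b, hbn⟩, ⟨a, ha⟩, ⟨b, hbn⟩, π ⟨a, ha⟩, hlt, hab, hb, hπ.1 _, rfl⟩
      · exact hπ.2.2 ⟨⟨a, ha⟩, ⟨b, hbn⟩, π ⟨a, ha⟩, π ⟨b, hbn⟩, hab, hb,
          Fin.lt_def.2 (by omega), rfl, rfl⟩
    · simp only [ha, dif_neg, not_false_eq_true] at hb
      omega

/-- Noncrossing pairings in the two encodings. -/
def equivPerm (n : ℕ) : NCPairing n ≃ {π : Equiv.Perm (Fin n) // IsNCPairing π} where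
  toFun p := ⟨p.toPerm, p.isNCPairing_toPerm⟩
  invFun π := ofPerm π.1 π.2
  left_inv p := by
    ext t
    by_cases h : t < n
    · simp [ofPerm, h]
    · simp [ofPerm, h, p.f_out t (not_lt.1 h)]
  right_inv π := by
    apply Subtype.ext
    ext t
    simp [ofPerm]

noncomputable instance : Fintype (NCPairing n) := Fintype.ofEquiv _ (equivPerm n).symm

/-- The sign `(-1) ^ a`, where `a` is the sum of the left endpoints of the pairs. -/
def sgn (p : NCPairing n) : ℝ := ∏ t ∈ Finset.range n, if t < p.f t then (-1) ^ t else 1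

theorem sgn_ins {i : ℕ} (hi : i ≤ n) (σ : NCPairing n) :
    (ins i hi σ).sgn = (-1) ^ i * σ.sgn := by
  obtain ⟨k, rfl⟩ := Nat.exists_eq_add_of_le hi
  have h1 : ∀ t, (if skip i t < (ins i hi σ).f (skip i t) then (-1 : ℝ) ^ skip i t else 1) =
      if t < σ.f t then (-1) ^ t else 1 := by
    intro t
    have h2 : skip i t < skip i (σ.f t) ↔ t < σ.f t := by grind [skip]
    have h3 : (-1 : ℝ) ^ skip i t = (-1) ^ t := by
      unfold skip
      split_ifs
      · rfl
      · simp [pow_add]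
    rw [ins_f_skip, h3]
    simp only [h2]
  have h4 : i + k + 2 = (i + 2) + k := by omega
  have h5 : (ins i hi σ).f i = i + 1 := by simp [ins]
  have h6 : (ins i hi σ).f (i + 1) = i := by simp [ins]
  unfold sgn
  generalize (ins i hi σ).f = g at *
  rw [h4, Finset.prod_range_add _ (i + 2), Finset.prod_range_succ, Finset.prod_range_succ,
    Finset.prod_range_add _ i k, h5, h6]
  have h7 : ∀ t ∈ Finset.range i, (if t < g t then (-1 : ℝ) ^ t else 1) =
      if t < σ.f t then (-1) ^ t else 1 := fun t ht => by
    have := h1 t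
    rwa [show skip i t = t from if_pos (Finset.mem_range.1 ht)] at this
  have h8 : ∀ t ∈ Finset.range k, (if i + 2 + t < g (i + 2 + t)
      then (-1 : ℝ) ^ (i + 2 + t) else 1) =
      if i + t < σ.f (i + t) then (-1) ^ (i + t) else 1 := fun t ht => by
    have := h1 (i + t)
    have h9 : skip i (i + t) = i + 2 + t := by
      rw [skip, if_neg (by omega)]
      omega
    rwa [h9] at this
  rw [Finset.prod_congr rfl h7, Finset.prod_congr rfl h8]
  simp
  ring

theorem sgn_mul_self (p : NCPairing n) : p.sgn * p.sgn = 1 := by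
  rw [sgn, ← Finset.prod_mul_distrib]
  refine Finset.prod_eq_one fun t _ => ?_
  split_ifs
  · rw [← pow_add, ← two_mul, pow_mul]
    simp
  · simp

/-- Two positions of pairs are equal, adjacent, or apart. -/
theorem position_cases (i m : ℕ) : m = i ∨ m = i + 1 ∨ i = m + 1 ∨
    (∃ l, i ≤ l ∧ m = l + 2) ∨ ∃ l, m ≤ l ∧ i = l + 2 := by
  by_cases h1 : i + 2 ≤ m
  · exact Or.inr (Or.inr (Or.inr (Or.inl ⟨m - 2, by omega, by omega⟩)))
  by_cases h2 : m + 2 ≤ i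
  · exact Or.inr (Or.inr (Or.inr (Or.inr ⟨i - 2, by omega, by omega⟩)))
  omega

theorem sgn_of_cap_eq {n i : ℕ} (hi : i ≤ n) (p : NCPairing (n + 2)) :
    p ≠ ins i hi (cap i hi p) → p.sgn = -(ins i hi (cap i hi p)).sgn := by
  induction n using Nat.strong_induction_on generalizing i with
  | _ n ih =>
    intro hne
    obtain ⟨m, hm, σ, rfl⟩ := exists_ins p
    rcases position_cases i m with rfl | rfl | rfl | ⟨l, hl, rfl⟩ | ⟨l, hl, rfl⟩
    · rw [cap_ins_self] at hne
      exact absurd rfl hne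
    · rw [cap_ins_succ, sgn_ins, sgn_ins, pow_succ]
      ring
    · rw [cap_succ_ins, sgn_ins, sgn_ins, pow_succ]
      ring
    · obtain ⟨n, rfl⟩ : ∃ n', n = n' + 2 := ⟨n - 2, by omega⟩
      have hln : l ≤ n := by omega
      rw [cap_ins_of_le i l hl hln, ← ins_ins i l hl hln] at hne ⊢
      rw [sgn_ins, sgn_ins _ (ins _ _ _), ih n (by omega) (show i ≤ n by omega) σ
        (fun h => hne (congrArg (ins (l + 2) hm) h))]
      ring
    · obtain ⟨n, rfl⟩ : ∃ n', n = n' + 2 := ⟨n - 2, by omega⟩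
      have hln : l ≤ n := by omega
      rw [cap_ins_of_ge l m hl hln, ins_ins m l hl hln] at hne ⊢
      rw [sgn_ins, sgn_ins _ (ins _ _ _), ih n (by omega) hln σ
        (fun h => hne (congrArg (ins m hm) h))]
      ring

/-- A positive weight on noncrossing pairings, counting the ways of successively removing
adjacent pairs, where removing a pair at `m, m + 1` carries a factor concave in `m`. -/
noncomputable def weight : (n : ℕ) → NCPairing n → ℝ
  | 0, _ => 1
  | 1, _ => 1
  | n + 2, p => ∑ m : Fin (n + 1), ((m : ℝ) + 1) * (n + 1 - m) *
      ∑ σ : NCPairing n, if ins m m.is_le σ = p then weight n σ else 0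

theorem factor_pos {m : ℕ} (hm : m ≤ n) : 0 < ((m : ℝ) + 1) * (n + 1 - m) := by
  have : (m : ℝ) ≤ n := by exact_mod_cast hm
  have h0 : (0 : ℝ) ≤ m := m.cast_nonneg
  exact mul_pos (by linarith) (by linarith)

theorem weight_pos (p : NCPairing n) : 0 < weight n p := by
  induction n using Nat.strong_induction_on with
  | _ n ih =>
    match n, p, ih with
    | 0, _, _ => simp [weight]
    | 1, _, _ => simp [weight]
    | n + 2, p, ih =>
      have hnn : ∀ m : Fin (n + 1), ∀ σ : NCPairing n,
          0 ≤ if ins m m.is_le σ = p then weight n σ else 0 := fun m σ => by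
        split_ifs
        exacts [(ih n (by omega) σ).le, le_rfl]
      obtain ⟨i, hi, σ, hσ⟩ := exists_ins p
      rw [weight]
      refine Finset.sum_pos' (fun m _ => mul_nonneg (factor_pos m.is_le).le
        (Finset.sum_nonneg fun σ _ => hnn m σ)) ⟨⟨i, by omega⟩, Finset.mem_univ _, ?_⟩
      refine mul_pos (factor_pos hi) (Finset.sum_pos' (fun σ _ => hnn _ σ)
        ⟨σ, Finset.mem_univ _, ?_⟩)
      rw [if_pos hσ.symm]
      exact ih n (by omega) σ

theorem sum_factor {i : ℕ} (hi : i ≤ n) :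
    ∑ m : Fin (n + 1), ((m : ℝ) + 1) * (n + 1 - m) *
      (if (m : ℕ) = i then 2 else if (m : ℕ) = i + 1 ∨ i = m + 1 then -1 else 0) = 2 := by
  have h : ∀ m : ℕ, ((m : ℝ) + 1) * (n + 1 - m) *
      (if m = i then 2 else if m = i + 1 ∨ i = m + 1 then -1 else 0) =
      (if m = i then ((m : ℝ) + 1) * (n + 1 - m) * 2 else 0) -
      (if m = i + 1 then ((m : ℝ) + 1) * (n + 1 - m) else 0) -
      (if i = m + 1 then ((m : ℝ) + 1) * (n + 1 - m) else 0) := fun m => by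
    split_ifs <;> first | omega | ring
  rw [Fin.sum_univ_eq_sum_range (fun m : ℕ => ((m : ℝ) + 1) * (n + 1 - m) *
    (if m = i then 2 else if m = i + 1 ∨ i = m + 1 then -1 else 0)) (n + 1),
    Finset.sum_congr rfl fun m _ => h m, Finset.sum_sub_distrib, Finset.sum_sub_distrib,
    Finset.sum_ite_eq', Finset.sum_ite_eq', if_pos (Finset.mem_range.2 (by omega))]
  have h1 : (if i + 1 ∈ Finset.range (n + 1) then
      (((i + 1 : ℕ) : ℝ) + 1) * (n + 1 - ((i + 1 : ℕ) : ℝ)) else 0) = (i + 2) * (n - i) := by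
    split_ifs with h1
    · push_cast
      ring
    · obtain rfl : i = n := by
        rw [Finset.mem_range] at h1
        omega
      simp
  have h2 : (∑ m ∈ Finset.range (n + 1), if i = m + 1 then ((m : ℝ) + 1) * (n + 1 - m) else 0) =
      i * (n + 2 - i) := by
    rcases i with _ | i
    · simp
    · simp only [Nat.add_right_cancel_iff]
      rw [Finset.sum_ite_eq, if_pos (Finset.mem_range.2 (by omega))]
      push_cast
      ring
  rw [h1, h2]
  ring

theorem sum_mul_le_of_sum_eq_two {ι : Type*} [Fintype ι] {c e A B : ι → ℝ} {w : ℝ}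
    (he : ∑ m, c m * e m = 2) (hc : ∀ m, 0 ≤ c m) (h : ∀ m, e m * w ≤ 3 * B m - A m) :
    ∑ m, c m * A m + 2 * w ≤ 3 * ∑ m, c m * B m := by
  rw [← he, Finset.sum_mul, Finset.mul_sum, ← Finset.sum_add_distrib]
  refine Finset.sum_le_sum fun m _ => ?_
  have := mul_le_mul_of_nonneg_left (h m) (hc m)
  linarith

theorem sum_cap_weight_le {i : ℕ} (hi : i ≤ n) (π : NCPairing n) :
    (∑ p : NCPairing (n + 2), if cap i hi p = π then weight (n + 2) p else 0) + 2 * weight n π ≤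
      3 * weight (n + 2) (ins i hi π) := by
  induction n using Nat.strong_induction_on generalizing i with
  | _ n ih =>
    have hA : (∑ p : NCPairing (n + 2), if cap i hi p = π then weight (n + 2) p else 0) =
        ∑ m : Fin (n + 1), ((m : ℝ) + 1) * (n + 1 - m) *
          ∑ σ : NCPairing n, if cap i hi (ins m m.is_le σ) = π then weight n σ else 0 := by
      have h : ∀ p : NCPairing (n + 2), (if cap i hi p = π then weight (n + 2) p else 0) =
          ∑ m : Fin (n + 1), ((m : ℝ) + 1) * (n + 1 - m) * ∑ σ : NCPairing n,
            if ins m m.is_le σ = p then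
              if cap i hi (ins m m.is_le σ) = π then weight n σ else 0 else 0 := by
        intro p
        split_ifs with hp
        · rw [weight]
          refine Finset.sum_congr rfl fun m _ => ?_
          congr 1
          refine Finset.sum_congr rfl fun σ _ => ?_
          split_ifs with h1 h2
          · rfl
          · exact absurd (h1 ▸ hp) h2
          · rfl
        · refine (Finset.sum_eq_zero fun m _ => ?_).symm
          rw [Finset.sum_eq_zero, mul_zero]
          intro σ _
          split_ifs with h1 h2
          · exact absurd (h1 ▸ h2) hp
          · rfl
          · rfl
      rw [Finset.sum_congr rfl fun p _ => h p, Finset.sum_comm]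
      refine Finset.sum_congr rfl fun m _ => ?_
      rw [← Finset.mul_sum, Finset.sum_comm]
      simp
    have hterm : ∀ m : Fin (n + 1),
        (if (m : ℕ) = i then 2 else if (m : ℕ) = i + 1 ∨ i = m + 1 then -1 else 0) * weight n π ≤
        3 * (∑ σ : NCPairing n, if ins m m.is_le σ = ins i hi π then weight n σ else 0) -
          ∑ σ : NCPairing n, if cap i hi (ins m m.is_le σ) = π then weight n σ else 0 := by
      rintro ⟨m, hm⟩
      simp only
      have hnn : ∀ σ : NCPairing n,
          0 ≤ if ins m (by omega) σ = ins i hi π then weight n σ else 0 := fun σ => by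
        split_ifs
        exacts [(weight_pos σ).le, le_rfl]
      have hB : ∀ σ : NCPairing n, ins m (by omega) σ = ins i hi π →
          weight n σ ≤ ∑ σ : NCPairing n,
            if ins m (by omega) σ = ins i hi π then weight n σ else 0 := fun σ hσ => by
        have := Finset.single_le_sum (fun σ _ => hnn σ) (Finset.mem_univ σ)
        rwa [if_pos hσ] at this
      have hB0 := Finset.sum_nonneg fun σ (_ : σ ∈ Finset.univ) => hnn σ
      rcases position_cases i m with rfl | rfl | rfl | ⟨l, hl, rfl⟩ | ⟨l, hl, rfl⟩
      · have := hB π rfl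
        simp only [cap_ins_self, Finset.sum_ite_eq', Finset.mem_univ, if_true]
        linarith
      · simp only [cap_ins_succ, Finset.sum_ite_eq', Finset.mem_univ, if_true]
        simp
        linarith
      · simp only [cap_succ_ins, Finset.sum_ite_eq', Finset.mem_univ, if_true]
        simp
        linarith
      · obtain ⟨n, rfl⟩ : ∃ n', n = n' + 2 := ⟨n - 2, by omega⟩
        have hln : l ≤ n := by omega
        rw [if_neg (by omega), if_neg (by omega), zero_mul]
        simp only [cap_ins_of_le i l hl hln]
        by_cases hπ : ∃ ρ, ins l hln ρ = π
        · obtain ⟨ρ, rfl⟩ := hπ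
          have h1 := hB (ins i (by omega) ρ) (ins_ins i l hl hln ρ)
          have h2 := ih n (by omega) (i := i) (by omega) ρ
          have h3 := weight_pos ρ
          have h4 : ∀ σ : NCPairing (n + 2), (ins l hln (cap i (by omega) σ) = ins l hln ρ ↔
              cap i (by omega) σ = ρ) := fun σ =>
            ⟨fun h => by simpa [cap_ins_self] using congrArg (cap l hln) h, fun h => by rw [h]⟩
          simp only [h4]
          linarith
        · rw [Finset.sum_eq_zero (fun σ _ => if_neg fun h => hπ ⟨_, h⟩)]
          linarith
      · obtain ⟨n, rfl⟩ : ∃ n', n = n' + 2 := ⟨n - 2, by omega⟩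
        have hln : l ≤ n := by omega
        rw [if_neg (by omega), if_neg (by omega), zero_mul]
        simp only [cap_ins_of_ge l m hl hln]
        have hmn : m ≤ n := by omega
        by_cases hπ : ∃ ρ, ins m hmn ρ = π
        · obtain ⟨ρ, rfl⟩ := hπ
          have h1 := hB (ins l hln ρ) (ins_ins m l hl hln ρ).symm
          have h2 := ih n (by omega) hln ρ
          have h3 := weight_pos ρ
          have h4 : ∀ σ : NCPairing (n + 2), (ins m hmn (cap l hln σ) = ins m hmn ρ ↔
              cap l hln σ = ρ) := fun σ =>
            ⟨fun h => by simpa [cap_ins_self] using congrArg (cap m hmn) h, fun h => by rw [h]⟩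
          simp only [h4]
          linarith
        · rw [Finset.sum_eq_zero (fun σ _ => if_neg fun h => hπ ⟨_, h⟩)]
          linarith
    rw [hA, weight]
    exact sum_mul_le_of_sum_eq_two (sum_factor hi) (fun m => (factor_pos m.is_le).le) hterm

/-- The Temperley-Lieb cap at `i, i + 1` with loop value `x`, acting on coefficients that have
been multiplied by the sign `sgn`. -/
noncomputable def signedCap (x : ℝ) (i : ℕ) (hi : i ≤ n) (y : NCPairing (n + 2) → ℝ)
    (π : NCPairing n) : ℝ :=
  (x + 1) * y (ins i hi π) - ∑ p : NCPairing (n + 2), if cap i hi p = π then y p else 0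

theorem nonneg_of_signedCap_nonneg {x : ℝ} (hx : 2 ≤ x) (y : NCPairing (n + 2) → ℝ)
    (hy : ∀ i (hi : i ≤ n) π, 0 ≤ signedCap x i hi y π) (p : NCPairing (n + 2)) : 0 ≤ y p := by
  obtain ⟨p₀, -, hp₀⟩ := Finset.exists_min_image Finset.univ (fun p => y p / weight _ p)
    ⟨p, Finset.mem_univ p⟩
  set μ := y p₀ / weight _ p₀ with hμ
  have hle : ∀ p, μ * weight _ p ≤ y p := fun p =>
    (le_div_iff₀ (weight_pos p)).1 (hp₀ p (Finset.mem_univ p))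
  have heq : y p₀ = μ * weight _ p₀ := by
    rw [hμ, div_mul_cancel₀ _ (weight_pos p₀).ne']
  suffices 0 ≤ μ from (mul_nonneg this (weight_pos p).le).trans (hle p)
  by_contra! hneg
  obtain ⟨i, hi, π, rfl⟩ := exists_ins p₀
  have h1 := hy i hi π
  have h2 := sum_cap_weight_le hi π
  have h3 := weight_pos π
  have h4 : μ * (∑ p : NCPairing (n + 2), if cap i hi p = π then weight (n + 2) p else 0) ≤
      ∑ p : NCPairing (n + 2), if cap i hi p = π then y p else 0 := by
    rw [Finset.mul_sum]
    refine Finset.sum_le_sum fun p _ => ?_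
    split_ifs
    · exact hle p
    · simp
  rw [signedCap, heq] at h1
  have h5 := weight_pos (ins i hi π)
  nlinarith [mul_nonneg (sub_nonneg.2 hx) h5.le]

theorem pos_of_signedCap_nonneg {x : ℝ} (y : NCPairing (n + 2) → ℝ)
    (hy : ∀ i (hi : i ≤ n) π, 0 ≤ signedCap x i hi y π) (hy0 : ∀ p, 0 ≤ y p)
    {j : ℕ} (hj : j ≤ n) (hpos : ∀ π, 0 < signedCap x j hj y π) (p : NCPairing (n + 2)) :
    0 < y p := by
  have hzero : ∀ i (hi : i ≤ n) π, y (ins i hi π) = 0 →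
      signedCap x i hi y π ≤ 0 ∧ ∀ p, cap i hi p = π → y p = 0 := by
    intro i hi π h
    have h1 := hy i hi π
    have hnn : ∀ p ∈ Finset.univ, 0 ≤ if cap i hi p = π then y p else 0 := fun p _ => by
      split_ifs
      exacts [hy0 p, le_rfl]
    have h2 := Finset.sum_nonneg hnn
    rw [signedCap, h, mul_zero] at h1 ⊢
    refine ⟨by linarith, fun p hp => ?_⟩
    have h3 := (Finset.sum_eq_zero_iff_of_nonneg hnn).1 (by linarith) p (Finset.mem_univ p)
    rwa [if_pos hp] at h3
  have hne : ∀ (d i : ℕ) (hi : i ≤ n) (π : NCPairing n), i ≤ j + d → j ≤ i + d →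
      y (ins i hi π) ≠ 0 := by
    intro d
    induction d with
    | zero =>
      intro i hi π h1 h2 h
      obtain rfl : i = j := by omega
      exact (hpos π).not_ge (hzero i hi π h).1
    | succ d ih =>
      intro i hi π h1 h2 h
      rcases lt_trichotomy i j with hij | rfl | hij
      · exact ih (i + 1) (by omega) π (by omega) (by omega)
          ((hzero i hi π h).2 _ (cap_ins_succ i (by omega) π))
      · exact (hpos π).not_ge (hzero i hi π h).1
      · obtain ⟨i, rfl⟩ : ∃ i', i = i' + 1 := ⟨i - 1, by omega⟩
        exact ih i (by omega) π (by omega) (by omega)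
          ((hzero (i + 1) hi π h).2 _ (cap_succ_ins i hi π))
  obtain ⟨i, hi, π, rfl⟩ := exists_ins p
  exact (hy0 _).lt_of_ne' (hne (i + j) i hi π (by omega) (by omega))

/-- The orbit of `t` under the group generated by two permutations. -/
def orb {m : ℕ} (π τ : Equiv.Perm (Fin m)) (t : Fin m) :
    MulAction.orbitRel.Quotient (↥(Subgroup.closure {π, τ})) (Fin m) :=
  Quotient.mk'' t

theorem orb_left {m : ℕ} (π τ : Equiv.Perm (Fin m)) (t : Fin m) : orb π τ (π t) = orb π τ t :=
  Quotient.sound' ⟨⟨π, Subgroup.subset_closure (by simp)⟩, rfl⟩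

theorem orb_right {m : ℕ} (π τ : Equiv.Perm (Fin m)) (t : Fin m) : orb π τ (τ t) = orb π τ t :=
  Quotient.sound' ⟨⟨τ, Subgroup.subset_closure (by simp)⟩, rfl⟩

/-- A function invariant under two permutations descends to the orbits. -/
def orbLift {m : ℕ} {π τ : Equiv.Perm (Fin m)} {A : Type*} (φ : Fin m → A)
    (h1 : ∀ t, φ (π t) = φ t) (h2 : ∀ t, φ (τ t) = φ t) :
    MulAction.orbitRel.Quotient (↥(Subgroup.closure {π, τ})) (Fin m) → A :=
  Quotient.lift φ <| by
    rintro a b ⟨⟨g, hg⟩, rfl⟩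
    change φ (g b) = φ b
    induction hg using Subgroup.closure_induction generalizing b with
    | mem g hg =>
      rcases hg with rfl | rfl
      exacts [h1 b, h2 b]
    | one => rfl
    | mul g h _ _ hg hh => exact (hg (h b)).trans (hh b)
    | inv g _ hg => simpa using (hg (g⁻¹ b)).symm

@[simp]
theorem orbLift_orb {m : ℕ} {π τ : Equiv.Perm (Fin m)} {A : Type*} (φ : Fin m → A)
    (h1 : ∀ t, φ (π t) = φ t) (h2 : ∀ t, φ (τ t) = φ t) (t : Fin m) :
    orbLift φ h1 h2 (orb π τ t) = φ t := rfl

/-- The loop through a point `t < n` formed by two noncrossing pairings. -/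
noncomputable def loopOf (p q : NCPairing n) (t : ℕ) :
    Option (MulAction.orbitRel.Quotient (↥(Subgroup.closure {p.toPerm, q.toPerm})) (Fin n)) :=
  if h : t < n then some (orb p.toPerm q.toPerm ⟨t, h⟩) else none

theorem loopOf_of_lt (p q : NCPairing n) {t : ℕ} (h : t < n) :
    loopOf p q t = some (orb p.toPerm q.toPerm ⟨t, h⟩) := dif_pos h

theorem loopOf_left (p q : NCPairing n) (t : ℕ) : loopOf p q (p.f t) = loopOf p q t := by
  by_cases h : t < n
  · rw [loopOf_of_lt p q h, loopOf_of_lt p q (p.f_lt t h)]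
    exact congrArg some (orb_left p.toPerm q.toPerm ⟨t, h⟩)
  · rw [p.f_out t (not_lt.1 h)]

theorem loopOf_right (p q : NCPairing n) (t : ℕ) : loopOf p q (q.f t) = loopOf p q t := by
  by_cases h : t < n
  · rw [loopOf_of_lt p q h, loopOf_of_lt p q (q.f_lt t h)]
    exact congrArg some (orb_right p.toPerm q.toPerm ⟨t, h⟩)
  · rw [q.f_out t (not_lt.1 h)]

theorem loops_eq_card (p q : NCPairing n) {A : Type*} (φ : Fin n → A)
    (h1 : ∀ t, φ (p.toPerm t) = φ t) (h2 : ∀ t, φ (q.toPerm t) = φ t)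
    (hφ : Function.Surjective φ)
    (ψ : A → Option (MulAction.orbitRel.Quotient
      (↥(Subgroup.closure {p.toPerm, q.toPerm})) (Fin n)))
    (hψ : ∀ t, ψ (φ t) = loopOf p q t) : loops p.toPerm q.toPerm = Nat.card A := by
  refine Nat.card_eq_of_bijective (orbLift φ h1 h2) ⟨fun c d h => ?_, fun a => ?_⟩
  · induction c using Quotient.inductionOn' with
    | _ s =>
      induction d using Quotient.inductionOn' with
      | _ t =>
        have h3 : φ s = φ t := h
        have h4 := hψ s
        rw [h3, hψ t, loopOf_of_lt p q t.2, loopOf_of_lt p q s.2] at h4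
        exact (Option.some_injective _ h4).symm
  · obtain ⟨t, rfl⟩ := hφ a
    exact ⟨orb _ _ t, rfl⟩

theorem skip_lt {i t : ℕ} (ht : t < n) : skip i t < n + 2 := by
  grind [skip]

theorem unskip_lt {i t : ℕ} (hi : i ≤ n) (ht : t < n + 2) (h0 : t ≠ i) (h1 : t ≠ i + 1) :
    unskip i t < n := by
  grind [unskip]

theorem skip_unskip {i t : ℕ} (h0 : t ≠ i) (h1 : t ≠ i + 1) : skip i (unskip i t) = t := by
  grind [skip, unskip]

theorem unskip_skip (i t : ℕ) : unskip i (skip i t) = t := by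
  grind [skip, unskip]

theorem ins_f_self {i : ℕ} (hi : i ≤ n) (σ : NCPairing n) : (ins i hi σ).f i = i + 1 := by
  simp [ins]

theorem ins_f_succ {i : ℕ} (hi : i ≤ n) (σ : NCPairing n) : (ins i hi σ).f (i + 1) = i := by
  simp [ins]

theorem skip_ne (i t : ℕ) : skip i t ≠ i ∧ skip i t ≠ i + 1 := by
  grind [skip]

@[elab_as_elim]
theorem skip_cases (i : ℕ) {P : ℕ → Prop} (left : P i) (right : P (i + 1))
    (skip : ∀ s, P (skip i s)) (t : ℕ) : P t := by
  by_cases h0 : t = i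
  · exact h0 ▸ left
  by_cases h1 : t = i + 1
  · exact h1 ▸ right
  exact skip_unskip h0 h1 ▸ skip _

theorem loops_ins_ins {i : ℕ} (hi : i ≤ n) (π ρ : NCPairing n) :
    loops (ins i hi π).toPerm (ins i hi ρ).toPerm = loops π.toPerm ρ.toPerm + 1 := by
  let φ : ℕ → Option _ := fun t => if t = i ∨ t = i + 1 then none else loopOf π ρ (unskip i t)
  have hφ0 : φ i = none := by simp [φ]
  have hφ1 : φ (i + 1) = none := by simp [φ]
  have hφ2 : ∀ t, φ (skip i t) = loopOf π ρ t := fun t => by simp [φ, skip_ne, unskip_skip]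
  have hinv : ∀ σ : NCPairing n, (∀ t, loopOf π ρ (σ.f t) = loopOf π ρ t) →
      ∀ t, φ ((ins i hi σ).f t) = φ t := by
    intro σ hσ t
    induction t using skip_cases i with
    | left => rw [ins_f_self, hφ0, hφ1]
    | right => rw [ins_f_succ, hφ0, hφ1]
    | skip s => rw [ins_f_skip, hφ2, hφ2, hσ]
  let χ : Fin n → Option _ := fun t => loopOf (ins i hi π) (ins i hi ρ) (skip i t)
  have hχ1 : ∀ t, χ (π.toPerm t) = χ t := fun t => by
    simp only [χ, toPerm_val, ← ins_f_skip hi, loopOf_left]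
  have hχ2 : ∀ t, χ (ρ.toPerm t) = χ t := fun t => by
    simp only [χ, toPerm_val, ← ins_f_skip hi, loopOf_right]
  rw [loops_eq_card (ins i hi π) (ins i hi ρ) (fun t => φ t) (fun t => hinv π (loopOf_left π ρ) t)
    (fun t => hinv ρ (loopOf_right π ρ) t) ?_
    (fun a => a.elim (loopOf (ins i hi π) (ins i hi ρ) i) (orbLift χ hχ1 hχ2)) ?_]
  · exact Finite.card_option
  · rintro (_ | a)
    · exact ⟨⟨i, by omega⟩, hφ0⟩
    · induction a using Quotient.inductionOn' with
      | _ s => exact ⟨⟨skip i s, skip_lt s.2⟩, (hφ2 s).trans (loopOf_of_lt π ρ s.2)⟩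
  · rintro ⟨t, ht⟩
    simp only
    induction t using skip_cases i with
    | left => rw [hφ0, Option.elim_none]
    | right =>
      rw [hφ1, Option.elim_none, ← loopOf_left _ _ i, ins_f_self]
    | skip s =>
      have hs : s < n := by grind [skip]
      rw [hφ2, loopOf_of_lt π ρ hs]
      rfl

theorem cap_f {i : ℕ} (hi : i ≤ n) (p : NCPairing (n + 2)) (t : ℕ) : (cap i hi p).f t =
    if p.f (skip i t) = i then unskip i (p.f (i + 1))
    else if p.f (skip i t) = i + 1 then unskip i (p.f i) else unskip i (p.f (skip i t)) := rfl

theorem loops_ins_of_ne {i : ℕ} (hi : i ≤ n) (π : NCPairing n) (p : NCPairing (n + 2))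
    (hp : p.f i ≠ i + 1) :
    loops (ins i hi π).toPerm p.toPerm = loops π.toPerm (cap i hi p).toPerm := by
  have hp0 := p.f_f i
  have hp1 := p.f_f (i + 1)
  have hn0 := p.f_ne i
  have hn1 := p.f_ne (i + 1)
  have hp' : p.f (i + 1) ≠ i := fun h => hp (by rwa [h] at hp1)
  let g : ℕ → ℕ := fun t =>
    if t = i then unskip i (p.f i) else if t = i + 1 then unskip i (p.f (i + 1)) else unskip i t
  have hg0 : g i = unskip i (p.f i) := by simp [g]
  have hg1 : g (i + 1) = unskip i (p.f (i + 1)) := by simp [g]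
  have hg2 : ∀ t, g (skip i t) = t := fun t => by simp [g, skip_ne, unskip_skip]
  have hg : ∀ t, t < n + 2 → g t < n := by
    intro t ht
    induction t using skip_cases i with
    | left => exact hg0 ▸ unskip_lt hi (p.f_lt _ ht) (by grind) hp
    | right => exact hg1 ▸ unskip_lt hi (p.f_lt _ ht) hp' (by grind)
    | skip s =>
      rw [hg2]
      grind [skip]
  set c := cap i hi p with hc
  have hinv1 : ∀ t, loopOf π c (g ((ins i hi π).f t)) = loopOf π c (g t) := by
    have hcap : loopOf π c (g i) = loopOf π c (g (i + 1)) := by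
      rw [hg0, hg1, ← loopOf_right, hc, cap_f, skip_unskip (by grind) hp, if_pos hp0]
    intro t
    induction t using skip_cases i with
    | left => rw [ins_f_self, hcap]
    | right => rw [ins_f_succ, hcap]
    | skip s => rw [ins_f_skip, hg2, hg2, loopOf_left]
  have hinv2 : ∀ t, loopOf π c (g (p.f t)) = loopOf π c (g t) := by
    intro t
    induction t using skip_cases i with
    | left =>
      obtain ⟨s, hs⟩ : ∃ s, p.f i = skip i s := ⟨_, (skip_unskip (by grind) hp).symm⟩
      rw [hg0, hs, hg2, unskip_skip]
    | right =>
      obtain ⟨s, hs⟩ : ∃ s, p.f (i + 1) = skip i s := ⟨_, (skip_unskip hp' (by grind)).symm⟩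
      rw [hg1, hs, hg2, unskip_skip]
    | skip s =>
      have h := p.f_f (skip i s)
      by_cases h0 : p.f (skip i s) = i
      · rw [h0] at h ⊢
        rw [hg0, h, hg2, unskip_skip]
      by_cases h1 : p.f (skip i s) = i + 1
      · rw [h1] at h ⊢
        rw [hg1, h, hg2, unskip_skip]
      have h2 : c.f s = g (p.f (skip i s)) := by
        rw [hc, cap_f, if_neg h0, if_neg h1]
        simp [g, h0, h1]
      rw [← h2, loopOf_right, hg2]
  let L := loopOf (ins i hi π) p
  have hL : L i = L (i + 1) := by
    simp only [L]
    rw [← loopOf_left _ _ i, ins_f_self]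
  let χ : Fin n → Option _ := fun t => L (skip i t)
  have hχ1 : ∀ t, χ (π.toPerm t) = χ t := fun t => by
    simp only [χ, L, toPerm_val, ← ins_f_skip hi, loopOf_left]
  have hLp : ∀ t, L (p.f t) = L t := loopOf_right _ _
  have hχ2 : ∀ t, χ (c.toPerm t) = χ t := fun t => by
    simp only [χ, toPerm_val]
    rw [← hLp (skip i t), hc, cap_f]
    split_ifs with h0 h1
    · rw [skip_unskip hp' (by grind), hLp, h0, hL]
    · rw [skip_unskip (by grind) hp, hLp, h1, hL]
    · rw [skip_unskip h0 h1]
  refine loops_eq_card (ins i hi π) p (fun t => orb π.toPerm c.toPerm ⟨g t, hg t t.2⟩)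
    (fun t => ?_) (fun t => ?_) (fun a => ?_) (orbLift χ hχ1 hχ2) ?_
  · have := hinv1 t
    rw [loopOf_of_lt _ _ (hg _ t.2), loopOf_of_lt _ _ (hg _ ((ins i hi π).f_lt _ t.2))] at this
    exact Option.some_injective _ this
  · have := hinv2 t
    rw [loopOf_of_lt _ _ (hg _ t.2), loopOf_of_lt _ _ (hg _ (p.f_lt _ t.2))] at this
    exact Option.some_injective _ this
  · induction a using Quotient.inductionOn' with
    | _ s =>
      refine ⟨⟨skip i s, skip_lt s.2⟩, ?_⟩
      simp only [hg2]
      rfl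
  · rintro ⟨t, ht⟩
    simp only [orbLift_orb]
    change L (skip i (g t)) = L t
    induction t using skip_cases i with
    | left => rw [hg0, skip_unskip (by grind) hp, hLp]
    | right => rw [hg1, skip_unskip hp' (by grind), hLp]
    | skip s => rw [hg2]

/-- The Gram matrix of Temperley-Lieb diagrams on `n` points. -/
noncomputable def gram (n : ℕ) (x : ℝ) : Matrix (NCPairing n) (NCPairing n) ℝ :=
  fun p q => x ^ loops p.toPerm q.toPerm

theorem gram_ins {i : ℕ} (hi : i ≤ n) (x : ℝ) (π : NCPairing n) (p : NCPairing (n + 2)) :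
    gram (n + 2) x (ins i hi π) p =
      gram n x π (cap i hi p) * if p = ins i hi (cap i hi p) then x else 1 := by
  unfold gram
  split_ifs with h
  · rw [h, loops_ins_ins, cap_ins_self, pow_succ]
  · rw [loops_ins_of_ne hi π p fun h' => h (ins_cap hi p h').symm, mul_one]

theorem signedCap_eq {i : ℕ} (hi : i ≤ n) (x : ℝ) (y : NCPairing (n + 2) → ℝ)
    (ρ : NCPairing n) : (-1) ^ i * ρ.sgn * signedCap x i hi y ρ =
      ∑ p : NCPairing (n + 2), if cap i hi p = ρ then
        (if p = ins i hi (cap i hi p) then x else 1) * (p.sgn * y p) else 0 := by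
  have h1 : (x + 1) * y (ins i hi ρ) =
      ∑ p : NCPairing (n + 2), if p = ins i hi ρ then (x + 1) * y p else 0 := by simp
  rw [signedCap, h1, ← Finset.sum_sub_distrib, Finset.mul_sum, ← sgn_ins hi]
  refine Finset.sum_congr rfl fun p _ => ?_
  by_cases hp : cap i hi p = ρ
  · subst hp
    by_cases h : p = ins i hi (cap i hi p)
    · rw [if_pos h, if_pos rfl, if_pos rfl, if_pos h, ← h]
      ring
    · rw [if_neg h, if_pos rfl, if_pos rfl, if_neg h, sgn_of_cap_eq hi p h]
      ring
  · rw [if_neg hp, if_neg hp, if_neg fun h => hp (by rw [h, cap_ins_self])]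
    ring

theorem gram_mulVec_ins {i : ℕ} (hi : i ≤ n) (x : ℝ) (y : NCPairing (n + 2) → ℝ)
    (π : NCPairing n) : (gram (n + 2) x).mulVec (fun p => p.sgn * y p) (ins i hi π) =
      (gram n x).mulVec (fun ρ => (-1) ^ i * ρ.sgn * signedCap x i hi y ρ) π := by
  simp only [Matrix.mulVec, dotProduct, signedCap_eq, gram_ins, Finset.mul_sum, mul_ite, mul_zero]
  rw [Finset.sum_comm]
  refine Finset.sum_congr rfl fun p _ => ?_
  rw [Finset.sum_ite_eq, if_pos (Finset.mem_univ _)]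
  split_ifs <;> ring

theorem eq_inv_mulVec {x : ℝ} (hdet : IsUnit (gram n x).det) {v w : NCPairing n → ℝ}
    (h : (gram n x).mulVec v = w) : v = (gram n x)⁻¹.mulVec w := by
  rw [← h, Matrix.mulVec_mulVec, Matrix.nonsing_inv_mul _ hdet, Matrix.one_mulVec]

theorem sgn_ne_zero (p : NCPairing n) : p.sgn ≠ 0 := fun h => by
  simpa [h] using p.sgn_mul_self

theorem neg_one_pow_mul_sgn_mul_self (i : ℕ) (ρ : NCPairing n) :
    ((-1) ^ i * ρ.sgn) * ((-1) ^ i * ρ.sgn) = 1 := by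
  rw [mul_mul_mul_comm, sgn_mul_self, ← pow_add, ← two_mul, pow_mul]
  simp

theorem neg_one_pow_mul_sgn_ne_zero (i : ℕ) (ρ : NCPairing n) : (-1) ^ i * ρ.sgn ≠ 0 :=
  mul_ne_zero (pow_ne_zero _ (by norm_num)) ρ.sgn_ne_zero

theorem isUnit_det_gram_add_two {x : ℝ} (hx : 2 ≤ x) (hdet : IsUnit (gram n x).det) :
    IsUnit (gram (n + 2) x).det := by
  rw [← Matrix.isUnit_iff_isUnit_det, ← Matrix.mulVec_injective_iff_isUnit]
  suffices h : ∀ y : NCPairing (n + 2) → ℝ,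
      (gram (n + 2) x).mulVec (fun p => p.sgn * y p) = 0 → ∀ p, 0 ≤ y p by
    refine (injective_iff_map_eq_zero (gram (n + 2) x).mulVecLin).2 fun u hu => ?_
    have hu : (gram (n + 2) x).mulVec u = 0 := hu
    have hself : (fun p : NCPairing (n + 2) => p.sgn * (p.sgn * u p)) = u := by
      ext p
      rw [← mul_assoc, sgn_mul_self, one_mul]
    have hneg : (fun p : NCPairing (n + 2) => p.sgn * -(p.sgn * u p)) = -u := by
      ext p
      rw [mul_neg, ← mul_assoc, sgn_mul_self, one_mul, Pi.neg_apply]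
    ext p
    have h1 := h (fun p => p.sgn * u p) (by rw [hself, hu]) p
    have h2 := h (fun p => -(p.sgn * u p)) (by rw [hneg, Matrix.mulVec_neg, hu, neg_zero]) p
    have h3 : p.sgn * u p = 0 := le_antisymm (by linarith) h1
    exact (mul_eq_zero.1 h3).resolve_left p.sgn_ne_zero
  intro y hy
  refine nonneg_of_signedCap_nonneg hx y fun i hi π => ?_
  have h1 := eq_inv_mulVec hdet (funext fun π => (gram_mulVec_ins hi x y π).symm)
  simp only [hy] at h1
  have h2 := congrFun h1 π
  have h3 : (gram n x)⁻¹.mulVec (fun _ => 0) = 0 := Matrix.mulVec_zero _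
  simp only [Pi.zero_apply, h3] at h2
  exact ((mul_eq_zero.1 h2).resolve_left (neg_one_pow_mul_sgn_ne_zero i π)).ge

/-- The entries of the inverse Gram matrix, with signs removed. -/
noncomputable def absWg (n : ℕ) (x : ℝ) (q p : NCPairing n) : ℝ :=
  q.sgn * p.sgn * (gram n x)⁻¹ p q

theorem gram_mulVec_absWg {x : ℝ} (hdet : IsUnit (gram n x).det) (q p : NCPairing n) :
    (gram n x).mulVec (fun p => p.sgn * absWg n x q p) p = if p = q then q.sgn else 0 := by
  have h : (fun p : NCPairing n => p.sgn * absWg n x q p) =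
      q.sgn • fun p => (gram n x)⁻¹ p q := by
    ext p
    have := sgn_mul_self p
    simp only [absWg, Pi.smul_apply, smul_eq_mul]
    linear_combination q.sgn * (gram n x)⁻¹ p q * this
  have h2 : (gram n x).mulVec (fun p => (gram n x)⁻¹ p q) p = (1 : Matrix _ _ ℝ) p q := by
    rw [← Matrix.mul_nonsing_inv _ hdet]
    rfl
  rw [h, Matrix.mulVec_smul, Pi.smul_apply, h2, Matrix.one_apply]
  simp

theorem sgn_mul_signedCap_absWg {x : ℝ} (hdet : IsUnit (gram n x).det)
    (hdet' : IsUnit (gram (n + 2) x).det) {i : ℕ} (hi : i ≤ n) (q : NCPairing (n + 2))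
    (π : NCPairing n) : (-1) ^ i * π.sgn * signedCap x i hi (absWg (n + 2) x q) π =
      (gram n x)⁻¹.mulVec (fun ρ => if ins i hi ρ = q then q.sgn else 0) π := by
  have h1 := eq_inv_mulVec hdet
    (funext fun π => (gram_mulVec_ins hi x (absWg (n + 2) x q) π).symm)
  simp only [gram_mulVec_absWg hdet'] at h1
  exact congrFun h1 π

theorem signedCap_absWg_ins {x : ℝ} (hdet : IsUnit (gram n x).det)
    (hdet' : IsUnit (gram (n + 2) x).det) {i : ℕ} (hi : i ≤ n) (q π : NCPairing n) :
    signedCap x i hi (absWg (n + 2) x (ins i hi q)) π = absWg n x q π := by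
  have h1 := sgn_mul_signedCap_absWg hdet hdet' hi (ins i hi q) π
  have h2 : ∀ ρ, ins i hi ρ = ins i hi q ↔ ρ = q := fun ρ =>
    ⟨fun h => by simpa [cap_ins_self] using congrArg (cap i hi) h, fun h => by rw [h]⟩
  have h3 := neg_one_pow_mul_sgn_mul_self i π
  have h4 : ((-1 : ℝ) ^ i) * (-1) ^ i = 1 := by
    rw [← pow_add, ← two_mul, pow_mul]
    simp
  simp only [h2, Matrix.mulVec, dotProduct, mul_ite, mul_zero, Finset.sum_ite_eq',
    Finset.mem_univ, if_true, sgn_ins] at h1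
  rw [absWg]
  linear_combination (-1) ^ i * π.sgn * h1 -
    h3 * signedCap x i hi (absWg (n + 2) x (ins i hi q)) π +
    h4 * (π.sgn * q.sgn * (gram n x)⁻¹ π q)

theorem signedCap_absWg_of_forall_ne {x : ℝ} (hdet : IsUnit (gram n x).det)
    (hdet' : IsUnit (gram (n + 2) x).det) {i : ℕ} (hi : i ≤ n) (q : NCPairing (n + 2))
    (hq : ∀ ρ, ins i hi ρ ≠ q) (π : NCPairing n) :
    signedCap x i hi (absWg (n + 2) x q) π = 0 := by
  have h1 := sgn_mul_signedCap_absWg hdet hdet' hi q π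
  simp only [hq, if_false, Matrix.mulVec, dotProduct, mul_zero, Finset.sum_const_zero] at h1
  exact (mul_eq_zero.1 h1).resolve_left (neg_one_pow_mul_sgn_ne_zero i π)

theorem absWg_pos_add_two {x : ℝ} (hx : 2 ≤ x) (hdet : IsUnit (gram n x).det)
    (hpos : ∀ q p, 0 < absWg n x q p) (q p : NCPairing (n + 2)) : 0 < absWg (n + 2) x q p := by
  have hdet' := isUnit_det_gram_add_two hx hdet
  have h : ∀ i (hi : i ≤ n) π, 0 ≤ signedCap x i hi (absWg (n + 2) x q) π := by
    intro i hi π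
    by_cases hq : ∃ ρ, ins i hi ρ = q
    · obtain ⟨ρ, rfl⟩ := hq
      exact (signedCap_absWg_ins hdet hdet' hi ρ π).symm ▸ (hpos ρ π).le
    · push Not at hq
      exact (signedCap_absWg_of_forall_ne hdet hdet' hi q hq π).ge
  obtain ⟨j, hj, ρ, rfl⟩ := exists_ins q
  exact pos_of_signedCap_nonneg _ h (nonneg_of_signedCap_nonneg hx _ h) hj
    (fun π => (signedCap_absWg_ins hdet hdet' hj ρ π).symm ▸ hpos ρ π) p

theorem signedCap_sub (x x' : ℝ) {i : ℕ} (hi : i ≤ n) (y y' : NCPairing (n + 2) → ℝ)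
    (π : NCPairing n) : signedCap x i hi (fun p => y p - y' p) π =
      signedCap x i hi y π - signedCap x' i hi y' π + (x' - x) * y' (ins i hi π) := by
  have h : ∀ p, (if cap i hi p = π then y p - y' p else 0) =
      (if cap i hi p = π then y p else 0) - if cap i hi p = π then y' p else 0 := fun p => by
    split_ifs <;> simp
  simp only [signedCap, h, Finset.sum_sub_distrib]
  ring

theorem absWg_le_add_two {x x' : ℝ} (hx : 2 ≤ x) (hxx : x ≤ x') (hdet : IsUnit (gram n x).det)
    (hdet' : IsUnit (gram n x').det) (hpos : ∀ q p, 0 < absWg n x' q p)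
    (hle : ∀ q p, absWg n x' q p ≤ absWg n x q p) (q p : NCPairing (n + 2)) :
    absWg (n + 2) x' q p ≤ absWg (n + 2) x q p := by
  have hx' := hx.trans hxx
  refine sub_nonneg.1 (nonneg_of_signedCap_nonneg hx
    (fun p => absWg (n + 2) x q p - absWg (n + 2) x' q p) (fun i hi π => ?_) p)
  have h1 := mul_nonneg (sub_nonneg.2 hxx) (absWg_pos_add_two hx' hdet' hpos q (ins i hi π)).le
  rw [signedCap_sub x x']
  refine add_nonneg (sub_nonneg.2 ?_) h1
  have hdet₂ := isUnit_det_gram_add_two hx hdet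
  have hdet₂' := isUnit_det_gram_add_two hx' hdet'
  by_cases hq : ∃ ρ, ins i hi ρ = q
  · obtain ⟨ρ, rfl⟩ := hq
    rw [signedCap_absWg_ins hdet hdet₂, signedCap_absWg_ins hdet' hdet₂']
    exact hle ρ π
  · push Not at hq
    rw [signedCap_absWg_of_forall_ne hdet hdet₂ hi q hq,
      signedCap_absWg_of_forall_ne hdet' hdet₂' hi q hq]

instance : Subsingleton (NCPairing 0) :=
  ⟨fun p q => by
    ext t
    rw [p.f_out t t.zero_le, q.f_out t t.zero_le]⟩

instance : IsEmpty (NCPairing 1) :=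
  ⟨fun p => p.f_ne 0 one_pos (Nat.lt_one_iff.1 (p.f_lt 0 one_pos))⟩

theorem gram_zero (x : ℝ) : gram 0 x = 1 := by
  ext p q
  obtain rfl := Subsingleton.elim p q
  have h : loops p.toPerm p.toPerm = 0 := by
    have : IsEmpty (MulAction.orbitRel.Quotient
      (↥(Subgroup.closure {p.toPerm, p.toPerm})) (Fin 0)) :=
      ⟨fun c => Quotient.inductionOn' c fun t => t.elim0⟩
    exact Nat.card_of_isEmpty
  simp [gram, h]

theorem gram_properties (n : ℕ) :
    (∀ x : ℝ, 2 ≤ x → IsUnit (gram n x).det ∧ ∀ q p, 0 < absWg n x q p) ∧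
    ∀ x x' : ℝ, 2 ≤ x → x ≤ x' → ∀ q p, absWg n x' q p ≤ absWg n x q p := by
  induction n using Nat.twoStepInduction with
  | zero =>
    refine ⟨fun x _ => ⟨by simp [gram_zero], fun q p => ?_⟩, fun x x' _ _ q p => ?_⟩
    · obtain rfl := Subsingleton.elim p q
      simp [absWg, gram_zero, sgn_mul_self]
    · simp [absWg, gram_zero]
  | one =>
    exact ⟨fun x _ => ⟨by simp, fun q => isEmptyElim q⟩, fun x x' _ _ q => isEmptyElim q⟩
  | more n ih _ =>
    refine ⟨fun x hx => ?_, fun x x' hx hxx => ?_⟩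
    · obtain ⟨h1, h2⟩ := ih.1 x hx
      exact ⟨isUnit_det_gram_add_two hx h1, absWg_pos_add_two hx h1 h2⟩
    · obtain ⟨h1, -⟩ := ih.1 x hx
      obtain ⟨h3, h4⟩ := ih.1 x' (hx.trans hxx)
      exact absWg_le_add_two hx hxx h1 h3 h4 (ih.2 x x' hx hxx)

theorem tlGram_eq (k : ℕ) (x : ℝ) :
    tlGram k x = (gram (2 * k) x).submatrix (equivPerm (2 * k)).symm (equivPerm (2 * k)).symm := by
  ext π τ
  have h : ∀ π, (((equivPerm (2 * k)).symm π).toPerm) = π.1 := fun π =>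
    congrArg Subtype.val ((equivPerm (2 * k)).apply_symm_apply π)
  simp [tlGram, gram, h]

theorem tlGram_inv_apply (k : ℕ) (x : ℝ)
    (π τ : {π : Equiv.Perm (Fin (2 * k)) // IsNCPairing π}) : (tlGram k x)⁻¹ π τ =
      ((equivPerm (2 * k)).symm τ).sgn * ((equivPerm (2 * k)).symm π).sgn *
        absWg (2 * k) x ((equivPerm (2 * k)).symm τ) ((equivPerm (2 * k)).symm π) := by
  rw [tlGram_eq, Matrix.inv_submatrix_equiv, Matrix.submatrix_apply, absWg]
  generalize (equivPerm (2 * k)).symm τ = q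
  generalize (equivPerm (2 * k)).symm π = p
  have h1 := sgn_mul_self p
  have h2 := sgn_mul_self q
  linear_combination -(gram (2 * k) x)⁻¹ p q * (q.sgn * q.sgn * h1 + h2)

end NCPairing

/-- For every real `x ≥ 2` the Temperley–Lieb Gram matrix `G(x)` is invertible, all
entries of `G(x)⁻¹` (the free orthogonal quantum group Weingarten functions) are
nonzero, and each entry of `G(x)⁻¹` is a monotone function of `x` on `[2, ∞)`. -/
theorem stmt17 (k : ℕ) (hk : 1 ≤ k) :
    (∀ x : ℝ, 2 ≤ x → IsUnit (tlGram k x).det) ∧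
    (∀ x : ℝ, 2 ≤ x →
      ∀ π τ : {π : Equiv.Perm (Fin (2 * k)) // IsNCPairing π}, (tlGram k x)⁻¹ π τ ≠ 0) ∧
    (∀ π τ : {π : Equiv.Perm (Fin (2 * k)) // IsNCPairing π},
      MonotoneOn (fun x : ℝ => (tlGram k x)⁻¹ π τ) (Set.Ici (2 : ℝ)) ∨
      AntitoneOn (fun x : ℝ => (tlGram k x)⁻¹ π τ) (Set.Ici (2 : ℝ))) := by
  obtain ⟨h1, h2⟩ := NCPairing.gram_properties (2 * k)
  refine ⟨fun x hx => ?_, fun x hx π τ => ?_, fun π τ => ?_⟩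
  · rw [NCPairing.tlGram_eq, Matrix.det_submatrix_equiv_self]
    exact (h1 x hx).1
  · rw [NCPairing.tlGram_inv_apply]
    exact mul_ne_zero (mul_ne_zero (NCPairing.sgn_ne_zero _) (NCPairing.sgn_ne_zero _))
      ((h1 x hx).2 _ _).ne'
  · simp only [NCPairing.tlGram_inv_apply]
    rcases le_total 0 (((NCPairing.equivPerm (2 * k)).symm τ).sgn *
      ((NCPairing.equivPerm (2 * k)).symm π).sgn) with h | h
    · exact Or.inr fun x hx x' _ hxx => mul_le_mul_of_nonneg_left (h2 x x' hx hxx _ _) h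
    · exact Or.inl fun x hx x' _ hxx => mul_le_mul_of_nonpos_left (h2 x x' hx hxx _ _) h
end

section
/- Fix r ≥ 1, a real symmetric r×r matrix A, and for each n ∈ ℕ matrices A_1^{(n)}, …, A_r^{(n)} ∈ M_n(ℝ) such that for all i, j, (1/n)·Tr(A_i^{(n)} (A_j^{(n)})^t) → A_{ij} as n → ∞. Let μ_n denote the Haar probability measure on the real orthogonal group O(n). Then the random vector (Tr(A_1^{(n)} U), …, Tr(A_r^{(n)} U)), with U Haar-distributed on O(n), converges in moments to a centered Gaussian vector of covariance A: for every m ≥ 1 and every function s : {1,…,m} → {1,…,r}, lim_{n→∞} ∫_{O(n)} ∏_{t=1}^{m} Tr(A_{s(t)}^{(n)} U) dμ_n(U) = Σ_{p} ∏_{{a,b} ∈ p} A_{s(a) s(b)}, where the sum runs over all partitions p of {1,…,m} into two-element blocks (the limit being 0 when m is odd). -/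
open MeasureTheory Filter

noncomputable instance (n : ℕ) : MeasurableSpace (Matrix.orthogonalGroup (Fin n) ℝ) :=
  borel _

instance (n : ℕ) : BorelSpace (Matrix.orthogonalGroup (Fin n) ℝ) := ⟨rfl⟩

instance compactSpace_orthogonalGroup (n : ℕ) : CompactSpace (Matrix.orthogonalGroup (Fin n) ℝ) := by
  refine isCompact_iff_compactSpace.mp ?_
  have hK : IsCompact (Set.univ.pi fun _ : Fin n => Set.univ.pi fun _ : Fin n =>
      Set.Icc (-1 : ℝ) 1) :=
    isCompact_univ_pi fun _ => isCompact_univ_pi fun _ => isCompact_Icc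
  refine IsCompact.of_isClosed_subset (X := Matrix (Fin n) (Fin n) ℝ) hK isClosed_unitary ?_
  intro U hU i _ j _
  exact abs_le.mp (entry_norm_bound_of_unitary hU i j)

theorem Continuous.integrable_orthogonalGroup {n : ℕ}
    {μ : Measure (Matrix.orthogonalGroup (Fin n) ℝ)} [IsProbabilityMeasure μ]
    {f : Matrix.orthogonalGroup (Fin n) ℝ → ℝ} (hf : Continuous f) : Integrable f μ :=
  hf.integrable_of_hasCompactSupport (HasCompactSupport.of_compactSpace f)

/-- A matrix-valued curve has the given derivative at a point, entry by entry. -/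
def HasEntryDerivAt {n : ℕ} (R : ℝ → Matrix (Fin n) (Fin n) ℝ) (R' : Matrix (Fin n) (Fin n) ℝ)
    (x : ℝ) : Prop :=
  ∀ i j, HasDerivAt (fun θ => R θ i j) (R' i j) x

namespace HasEntryDerivAt

variable {n : ℕ} {R S : ℝ → Matrix (Fin n) (Fin n) ℝ} {R' S' : Matrix (Fin n) (Fin n) ℝ} {x : ℝ}

theorem const (M : Matrix (Fin n) (Fin n) ℝ) (x : ℝ) : HasEntryDerivAt (fun _ => M) 0 x :=
  fun i j => by simpa using hasDerivAt_const x (M i j)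

theorem mul (hR : HasEntryDerivAt R R' x) (hS : HasEntryDerivAt S S' x) :
    HasEntryDerivAt (fun θ => R θ * S θ) (R' * S x + R x * S') x := by
  intro i j
  simp only [Matrix.mul_apply, Matrix.add_apply, ← Finset.sum_add_distrib]
  exact HasDerivAt.fun_sum fun k _ => (hR i k).mul (hS k j)

theorem const_mul (M : Matrix (Fin n) (Fin n) ℝ) (hS : HasEntryDerivAt S S' x) :
    HasEntryDerivAt (fun θ => M * S θ) (M * S') x := by
  simpa using (const M x).mul hS

theorem mul_const (hR : HasEntryDerivAt R R' x) (M : Matrix (Fin n) (Fin n) ℝ) :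
    HasEntryDerivAt (fun θ => R θ * M) (R' * M) x := by
  simpa using hR.mul (const M x)

theorem trace (hR : HasEntryDerivAt R R' x) :
    HasDerivAt (fun θ => (R θ).trace) R'.trace x :=
  HasDerivAt.fun_sum fun i _ => hR i i

end HasEntryDerivAt

theorem hasEntryDerivAt_exp {n : ℕ} (X : Matrix (Fin n) (Fin n) ℝ) :
    HasEntryDerivAt (fun θ : ℝ => NormedSpace.exp (θ • X)) X 0 := by
  intro i j
  let _ := Matrix.linftyOpNormedRing (n := Fin n) (α := ℝ)
  let _ := Matrix.linftyOpNormedAlgebra (n := Fin n) (R := ℝ) (α := ℝ)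
  have h := hasDerivAt_exp_smul_const (𝕂 := ℝ) X 0
  rw [zero_smul, NormedSpace.exp_zero, one_mul] at h
  have h2 := ((Matrix.entryLinearMap ℝ ℝ i j).toContinuousLinearMap.hasFDerivAt).comp_hasDerivAt 0 h
  exact h2

theorem exp_smul_mem_orthogonalGroup {n : ℕ} {X : Matrix (Fin n) (Fin n) ℝ}
    (hX : X.transpose = -X) (θ : ℝ) :
    NormedSpace.exp (θ • X) ∈ Matrix.orthogonalGroup (Fin n) ℝ := by
  rw [Matrix.mem_orthogonalGroup_iff, ← Matrix.exp_transpose, Matrix.transpose_smul, hX,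
    ← Matrix.exp_add_of_commute _ _ (by simp)]
  simp

theorem integral_deriv_exp_eq_zero {n : ℕ} (μ : Measure (Matrix.orthogonalGroup (Fin n) ℝ))
    [IsProbabilityMeasure μ] [μ.IsMulRightInvariant] {X : Matrix (Fin n) (Fin n) ℝ}
    (hX : X.transpose = -X) {F G : Matrix (Fin n) (Fin n) ℝ → ℝ}
    (hF : Continuous F) (hG : Continuous G)
    (h : ∀ V, HasDerivAt (fun θ : ℝ => F (V * NormedSpace.exp (θ • X))) (G V) 0) :
    ∫ U : Matrix.orthogonalGroup (Fin n) ℝ, G U ∂μ = 0 := by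
  let E : ℝ → Matrix.orthogonalGroup (Fin n) ℝ :=
    fun θ => ⟨NormedSpace.exp (θ • X), exp_smul_mem_orthogonalGroup hX θ⟩
  have hE : ∀ (θ : ℝ) (U : Matrix.orthogonalGroup (Fin n) ℝ),
      ((U * E θ : Matrix.orthogonalGroup (Fin n) ℝ) : Matrix (Fin n) (Fin n) ℝ)
        = U * NormedSpace.exp (θ • X) := fun _ _ => rfl
  have hF' : Continuous fun U : Matrix.orthogonalGroup (Fin n) ℝ =>
    F (U : Matrix (Fin n) (Fin n) ℝ) := hF.comp continuous_subtype_val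
  have hG' : Continuous fun U : Matrix.orthogonalGroup (Fin n) ℝ =>
    G (U : Matrix (Fin n) (Fin n) ℝ) := hG.comp continuous_subtype_val
  obtain ⟨C, hC⟩ := isCompact_univ.exists_bound_of_continuousOn hG'.continuousOn
  have hFc : ∀ θ, Continuous fun U : Matrix.orthogonalGroup (Fin n) ℝ =>
    F ((U * E θ : Matrix.orthogonalGroup (Fin n) ℝ) : Matrix (Fin n) (Fin n) ℝ) :=
    fun θ => hF'.comp (continuous_mul_const (E θ))
  have hGc : ∀ θ, Continuous fun U : Matrix.orthogonalGroup (Fin n) ℝ =>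
    G ((U * E θ : Matrix.orthogonalGroup (Fin n) ℝ) : Matrix (Fin n) (Fin n) ℝ) :=
    fun θ => hG'.comp (continuous_mul_const (E θ))
  have key := (hasDerivAt_integral_of_dominated_loc_of_deriv_le (μ := μ) (x₀ := (0 : ℝ))
    (s := Set.univ) (bound := fun _ => C)
    (F := fun θ (U : Matrix.orthogonalGroup (Fin n) ℝ) =>
      F ((U * E θ : Matrix.orthogonalGroup (Fin n) ℝ) : Matrix (Fin n) (Fin n) ℝ))
    (F' := fun θ (U : Matrix.orthogonalGroup (Fin n) ℝ) =>
      G ((U * E θ : Matrix.orthogonalGroup (Fin n) ℝ) : Matrix (Fin n) (Fin n) ℝ))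
    Filter.univ_mem
    (Eventually.of_forall fun θ => (hFc θ).integrable_orthogonalGroup.aestronglyMeasurable)
    (hFc 0).integrable_orthogonalGroup
    (hGc 0).integrable_orthogonalGroup.aestronglyMeasurable
    (ae_of_all _ fun U θ _ => hC _ (Set.mem_univ _))
    (integrable_const C)
    (ae_of_all _ fun U θ _ => by
      have h1 := h ((U : Matrix (Fin n) (Fin n) ℝ) * NormedSpace.exp (θ • X))
      have h2 := HasDerivAt.comp_sub_const (f := fun τ : ℝ =>
        F ((U : Matrix (Fin n) (Fin n) ℝ) * NormedSpace.exp (θ • X) * NormedSpace.exp (τ • X)))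
        θ θ (by simpa using h1)
      refine h2.congr_of_eventuallyEq (Eventually.of_forall fun τ => ?_)
      simp only [hE]
      rw [mul_assoc, ← Matrix.exp_add_of_commute _ _
        (((Commute.refl X).smul_left θ).smul_right (τ - θ)), ← add_smul, add_sub_cancel])).2
  simp only [integral_mul_right_eq_self (μ := μ)
    (fun U : Matrix.orthogonalGroup (Fin n) ℝ => F (U : Matrix (Fin n) (Fin n) ℝ)),
    integral_mul_right_eq_self (μ := μ)
    (fun U : Matrix.orthogonalGroup (Fin n) ℝ => G (U : Matrix (Fin n) (Fin n) ℝ))] at key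
  exact key.unique (hasDerivAt_const _ _)

section SkewBasis

variable {n : ℕ}

/-- The standard generators `E_ab - E_ba` of the skew-symmetric matrices. -/
def skewUnit (a b : Fin n) : Matrix (Fin n) (Fin n) ℝ :=
  Matrix.single a b 1 - Matrix.single b a 1

theorem transpose_skewUnit (a b : Fin n) : (skewUnit a b).transpose = -skewUnit a b := by
  simp [skewUnit]

theorem trace_mul_skewUnit (M : Matrix (Fin n) (Fin n) ℝ) (a b : Fin n) :
    (M * skewUnit a b).trace = M b a - M a b := by
  simp [skewUnit, mul_sub, Matrix.trace_sub, Matrix.trace_mul_single]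

theorem trace_mul_eq_sum (M N : Matrix (Fin n) (Fin n) ℝ) :
    (M * N).trace = ∑ a, ∑ b, M a b * N b a := by
  simp [Matrix.trace, Matrix.mul_apply]

theorem sum_trace_mul_skewUnit_mul_trace (M N : Matrix (Fin n) (Fin n) ℝ) :
    ∑ a, ∑ b, (M * skewUnit a b).trace * (N * skewUnit a b).trace
      = 2 * ((M * N.transpose).trace - (M * N).trace) := by
  simp only [trace_mul_skewUnit]
  simp only [trace_mul_eq_sum, Matrix.transpose_apply]
  have h1 : ∑ a, ∑ b, M b a * N b a = ∑ a, ∑ b, M a b * N a b := Finset.sum_comm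
  have h2 : ∑ a, ∑ b, M b a * N a b = ∑ a, ∑ b, M a b * N b a := Finset.sum_comm
  simp only [sub_mul, mul_sub, Finset.sum_sub_distrib, h1, h2]
  ring

theorem trace_mul_skewUnit_mul_skewUnit (M N : Matrix (Fin n) (Fin n) ℝ) (a b : Fin n) :
    (M * skewUnit a b * N * skewUnit a b).trace
      = M b a * N b a + M a b * N a b - M a a * N b b - M b b * N a a := by
  have h : ∀ i j k l : Fin n, (M * Matrix.single i j 1 * N * Matrix.single k l 1).trace
      = M l i * N j k := by
    intro i j k l
    rw [Matrix.trace_mul_single, Matrix.mul_assoc, Matrix.mul_apply]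
    simp [Matrix.single_apply, Matrix.mul_apply, ite_and]
  simp only [skewUnit, mul_sub, sub_mul, Matrix.trace_sub, h]
  ring

theorem sum_trace_mul_skewUnit_mul_skewUnit (M N : Matrix (Fin n) (Fin n) ℝ) :
    ∑ a, ∑ b, (M * skewUnit a b * N * skewUnit a b).trace
      = 2 * ((M * N.transpose).trace - M.trace * N.trace) := by
  simp only [trace_mul_skewUnit_mul_skewUnit]
  simp only [trace_mul_eq_sum, Matrix.transpose_apply]
  have h1 : ∑ a, ∑ b, M b a * N b a = ∑ a, ∑ b, M a b * N a b := Finset.sum_comm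
  have h2 : ∑ a, ∑ b, M b b * N a a = ∑ a, ∑ b, M a a * N b b := Finset.sum_comm
  simp only [Finset.sum_sub_distrib, Finset.sum_add_distrib, h1, h2, Matrix.trace, Matrix.diag,
    Finset.sum_mul_sum]
  ring

theorem sum_trace_mul_skewUnit_sq (M : Matrix (Fin n) (Fin n) ℝ) :
    ∑ a, ∑ b, (M * skewUnit a b * skewUnit a b).trace = -(2 * ((n : ℝ) - 1) * M.trace) := by
  have h := sum_trace_mul_skewUnit_mul_skewUnit M 1
  simp only [mul_one, Matrix.transpose_one, Matrix.trace_one, Fintype.card_fin] at h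
  rw [h]
  ring

end SkewBasis

section SchwingerDyson

variable {n : ℕ} (μ : Measure (Matrix.orthogonalGroup (Fin n) ℝ))
  [IsProbabilityMeasure μ] [μ.IsMulRightInvariant]
  {ι : Type*} [DecidableEq ι] (S : Finset ι) (C : ι → Matrix (Fin n) (Fin n) ℝ)

/-- Schwinger–Dyson equation on the orthogonal group for a product of linear functionals. -/
theorem integral_schwingerDyson {Φ : Matrix (Fin n) (Fin n) ℝ → Matrix (Fin n) (Fin n) ℝ}
    {Φ' : Matrix (Fin n) (Fin n) ℝ → Matrix (Fin n) (Fin n) ℝ → Matrix (Fin n) (Fin n) ℝ}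
    (hΦ : Continuous Φ) (hΦ' : ∀ X, Continuous fun V => Φ' V X)
    (h : ∀ V X, HasEntryDerivAt (fun θ : ℝ => Φ (V * NormedSpace.exp (θ • X))) (Φ' V X) 0) :
    ∫ U : Matrix.orthogonalGroup (Fin n) ℝ,
      ((∑ a, ∑ b, (Φ' U (skewUnit a b) * skewUnit a b).trace) * ∏ t ∈ S, (C t * U).trace
        + ∑ t ∈ S, (2 * ((Φ U * (C t * U).transpose).trace - (Φ U * (C t * U)).trace))
            * ∏ u ∈ S.erase t, (C u * U).trace) ∂μ = 0 := by
  let G : Fin n → Fin n → Matrix (Fin n) (Fin n) ℝ → ℝ := fun a b V =>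
    (Φ' V (skewUnit a b) * skewUnit a b).trace * ∏ t ∈ S, (C t * V).trace
      + (Φ V * skewUnit a b).trace *
        ∑ t ∈ S, (∏ u ∈ S.erase t, (C u * V).trace) • (C t * (V * skewUnit a b)).trace
  have hG : ∀ a b, Continuous (G a b) := by
    intro a b
    have := hΦ' (skewUnit a b)
    fun_prop
  have hzero : ∀ a b, ∫ U : Matrix.orthogonalGroup (Fin n) ℝ, G a b U ∂μ = 0 := by
    intro a b
    refine integral_deriv_exp_eq_zero μ (transpose_skewUnit a b)
      (F := fun V => (Φ V * skewUnit a b).trace * ∏ t ∈ S, (C t * V).trace) (by fun_prop)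
      (hG a b) fun V => ?_
    have h1 := ((h V (skewUnit a b)).mul_const (skewUnit a b)).trace
    have h2 := HasDerivAt.fun_finsetProd (u := S) fun t _ =>
      (((hasEntryDerivAt_exp (skewUnit a b)).const_mul V).const_mul (C t)).trace
    simpa [G] using h1.fun_mul h2
  have hint : ∀ a b, Integrable (fun U : Matrix.orthogonalGroup (Fin n) ℝ => G a b U) μ :=
    fun a b => ((hG a b).comp continuous_subtype_val).integrable_orthogonalGroup
  have hsum : ∫ U : Matrix.orthogonalGroup (Fin n) ℝ, ∑ a, ∑ b, G a b U ∂μ = 0 := by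
    rw [integral_finsetSum _ fun a _ => integrable_finsetSum _ fun b _ => hint a b]
    refine Finset.sum_eq_zero fun a _ => ?_
    rw [integral_finsetSum _ fun b _ => hint a b]
    exact Finset.sum_eq_zero fun b _ => hzero a b
  rw [← hsum]
  congr 1
  ext U
  simp only [G, Finset.sum_add_distrib, ← Finset.sum_mul]
  congr 1
  simp only [← sum_trace_mul_skewUnit_mul_trace, Finset.mul_sum, Finset.sum_mul]
  rw [Finset.sum_comm]
  refine Finset.sum_congr rfl fun a _ => ?_
  rw [Finset.sum_comm]
  refine Finset.sum_congr rfl fun b _ => Finset.sum_congr rfl fun t _ => ?_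
  rw [smul_eq_mul, Matrix.mul_assoc]
  ring

theorem orthogonal_mul_transpose (U : Matrix.orthogonalGroup (Fin n) ℝ) :
    (U : Matrix (Fin n) (Fin n) ℝ) * (U : Matrix (Fin n) (Fin n) ℝ).transpose = 1 :=
  (Matrix.mem_orthogonalGroup_iff _ _).mp U.2

theorem mul_orthogonal_mul_transpose (M N : Matrix (Fin n) (Fin n) ℝ)
    (U : Matrix.orthogonalGroup (Fin n) ℝ) :
    M * (U : Matrix (Fin n) (Fin n) ℝ) * (N * (U : Matrix (Fin n) (Fin n) ℝ)).transpose
      = M * N.transpose := by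
  rw [Matrix.transpose_mul, Matrix.mul_assoc, ← Matrix.mul_assoc (U : Matrix (Fin n) (Fin n) ℝ),
    orthogonal_mul_transpose, Matrix.one_mul]

theorem integral_trace_mul_prod (A : Matrix (Fin n) (Fin n) ℝ) :
    ((n : ℝ) - 1) * ∫ U : Matrix.orthogonalGroup (Fin n) ℝ,
        (A * U).trace * ∏ t ∈ S, (C t * U).trace ∂μ
      = ∑ t ∈ S, ∫ U : Matrix.orthogonalGroup (Fin n) ℝ,
          ((A * (C t).transpose).trace - (A * U * (C t * U)).trace)
            * ∏ u ∈ S.erase t, (C u * U).trace ∂μ := by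
  have h := integral_schwingerDyson μ S C (Φ := fun V => A * V) (Φ' := fun V X => A * (V * X))
    (by fun_prop) (fun X => by fun_prop)
    fun V X => ((hasEntryDerivAt_exp X).const_mul V).const_mul A
  simp only [← Matrix.mul_assoc, sum_trace_mul_skewUnit_sq] at h
  simp only [Matrix.mul_assoc _ (C _) (Subtype.val _), mul_orthogonal_mul_transpose] at h
  rw [integral_add, integral_finsetSum] at h
  · simp only [mul_assoc, neg_mul, integral_neg, integral_const_mul, ← Finset.mul_sum] at h
    simp only [mul_assoc] at h ⊢
    linarith
  · exact fun t _ => Continuous.integrable_orthogonalGroup (by fun_prop)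
  · exact Continuous.integrable_orthogonalGroup (by fun_prop)
  · exact Continuous.integrable_orthogonalGroup (by fun_prop)

theorem integral_trace_mul_mul_mul_prod (A B : Matrix (Fin n) (Fin n) ℝ) :
    ((n : ℝ) - 1) * ∫ U : Matrix.orthogonalGroup (Fin n) ℝ,
        (A * U * (B * U)).trace * ∏ t ∈ S, (C t * U).trace ∂μ
      = (∫ U : Matrix.orthogonalGroup (Fin n) ℝ,
          ((A * B.transpose).trace - (A * U).trace * (B * U).trace)
            * ∏ t ∈ S, (C t * U).trace ∂μ)
        + ∑ t ∈ S, ∫ U : Matrix.orthogonalGroup (Fin n) ℝ,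
          ((A * U * B * (C t).transpose).trace - (A * U * (B * U) * (C t * U)).trace)
            * ∏ u ∈ S.erase t, (C u * U).trace ∂μ := by
  have h := integral_schwingerDyson μ S C (Φ := fun V => A * V * (B * V))
    (Φ' := fun V X => A * (V * X) * (B * V) + A * V * (B * (V * X)))
    (by fun_prop) (fun X => by fun_prop)
    fun V X => by
      have h1 := (((hasEntryDerivAt_exp X).const_mul V).const_mul A).mul
        (((hasEntryDerivAt_exp X).const_mul V).const_mul B)
      simpa using h1
  have h2 : ∀ U : Matrix.orthogonalGroup (Fin n) ℝ,
      ∑ a, ∑ b, ((A * ((U : Matrix (Fin n) (Fin n) ℝ) * skewUnit a b)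
          * (B * (U : Matrix (Fin n) (Fin n) ℝ))
        + A * (U : Matrix (Fin n) (Fin n) ℝ) * (B * ((U : Matrix (Fin n) (Fin n) ℝ)
          * skewUnit a b))) * skewUnit a b).trace
      = 2 * ((A * B.transpose).trace - (A * U).trace * (B * U).trace)
        - 2 * ((n : ℝ) - 1) * (A * U * (B * U)).trace := by
    intro U
    simp only [add_mul, Matrix.trace_add, Finset.sum_add_distrib, ← Matrix.mul_assoc,
      sum_trace_mul_skewUnit_sq]
    simp only [Matrix.mul_assoc _ B (Subtype.val _), sum_trace_mul_skewUnit_mul_skewUnit,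
      mul_orthogonal_mul_transpose]
    ring
  have h3 : ∀ (U : Matrix.orthogonalGroup (Fin n) ℝ) (t : ι),
      A * (U : Matrix (Fin n) (Fin n) ℝ) * (B * U) * (C t * U).transpose
        = A * U * B * (C t).transpose := by
    intro U t
    rw [← Matrix.mul_assoc _ B, mul_orthogonal_mul_transpose]
  simp only [h2, h3, sub_mul] at h
  rw [integral_add, integral_finsetSum, integral_sub] at h
  · simp only [mul_assoc, integral_const_mul, ← Finset.mul_sum] at h
    simp only [mul_assoc] at h ⊢
    linarith
  · exact Continuous.integrable_orthogonalGroup (by fun_prop)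
  · exact Continuous.integrable_orthogonalGroup (by fun_prop)
  · exact fun t _ => Continuous.integrable_orthogonalGroup (by fun_prop)
  · exact Continuous.integrable_orthogonalGroup (by fun_prop)
  · exact Continuous.integrable_orthogonalGroup (by fun_prop)

end SchwingerDyson

section FrobeniusBounds

variable {n : ℕ}

theorem trace_mul_transpose_eq_sum (M N : Matrix (Fin n) (Fin n) ℝ) :
    (M * N.transpose).trace = ∑ p : Fin n × Fin n, M p.1 p.2 * N p.1 p.2 := by
  rw [trace_mul_eq_sum, Fintype.sum_prod_type]
  rfl

theorem sq_trace_mul_transpose_le (M N : Matrix (Fin n) (Fin n) ℝ) :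
    (M * N.transpose).trace ^ 2 ≤ (M * M.transpose).trace * (N * N.transpose).trace := by
  simp only [trace_mul_transpose_eq_sum, ← sq]
  exact Finset.sum_mul_sq_le_sq_mul_sq _ _ _

theorem trace_mul_transpose_self_nonneg (M : Matrix (Fin n) (Fin n) ℝ) :
    0 ≤ (M * M.transpose).trace := by
  rw [trace_mul_transpose_eq_sum]
  exact Finset.sum_nonneg fun _ _ => mul_self_nonneg _

theorem trace_mul_mul_transpose_self_le (M N : Matrix (Fin n) (Fin n) ℝ) :
    (M * N * (M * N).transpose).trace
      ≤ (M * M.transpose).trace * (N * N.transpose).trace := by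
  rw [Matrix.trace_mul_comm N]
  simp only [trace_mul_eq_sum, Matrix.transpose_apply, ← sq]
  rw [Finset.sum_mul_sum]
  refine Finset.sum_le_sum fun i _ => Finset.sum_le_sum fun j _ => ?_
  rw [Matrix.mul_apply]
  exact Finset.sum_mul_sq_le_sq_mul_sq _ _ _

theorem trace_mul_orthogonal_mul_transpose_self (M : Matrix (Fin n) (Fin n) ℝ)
    (U : Matrix.orthogonalGroup (Fin n) ℝ) :
    (M * (U : Matrix (Fin n) (Fin n) ℝ) * (M * (U : Matrix (Fin n) (Fin n) ℝ)).transpose).trace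
      = (M * M.transpose).trace := by
  rw [mul_orthogonal_mul_transpose]

theorem abs_trace_mul_transpose_le {M N : Matrix (Fin n) (Fin n) ℝ} {a b : ℝ}
    (hM : (M * M.transpose).trace ≤ a) (hN : (N * N.transpose).trace ≤ b) :
    |(M * N.transpose).trace| ≤ √(a * b) :=
  Real.abs_le_sqrt <| (sq_trace_mul_transpose_le M N).trans <|
    mul_le_mul hM hN (trace_mul_transpose_self_nonneg N)
      ((trace_mul_transpose_self_nonneg M).trans hM)

theorem abs_trace_mul_le {M N : Matrix (Fin n) (Fin n) ℝ} {a b : ℝ}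
    (hM : (M * M.transpose).trace ≤ a) (hN : (N * N.transpose).trace ≤ b) :
    |(M * N).trace| ≤ √(a * b) := by
  have h := abs_trace_mul_transpose_le (N := N.transpose) (b := b) hM
    (by rwa [Matrix.transpose_transpose, Matrix.trace_mul_comm])
  rwa [Matrix.transpose_transpose] at h

variable {A B C : Matrix (Fin n) (Fin n) ℝ} {K : ℝ}
  (hA : (A * A.transpose).trace ≤ K) (hB : (B * B.transpose).trace ≤ K)
  (hC : (C * C.transpose).trace ≤ K) (U : Matrix.orthogonalGroup (Fin n) ℝ)

include hA hB

theorem abs_trace_mul_transpose_le_self : |(A * B.transpose).trace| ≤ K := by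
  have hK := (trace_mul_transpose_self_nonneg A).trans hA
  simpa [Real.sqrt_mul_self hK] using abs_trace_mul_transpose_le hA hB

theorem abs_trace_mul_orthogonal_le : |(A * U * (B * U)).trace| ≤ K := by
  have hK := (trace_mul_transpose_self_nonneg A).trans hA
  rw [← trace_mul_orthogonal_mul_transpose_self A U] at hA
  rw [← trace_mul_orthogonal_mul_transpose_self B U] at hB
  simpa [Real.sqrt_mul_self hK] using abs_trace_mul_le hA hB

include hC

theorem abs_trace_mul_orthogonal_mul_transpose_le :
    |(A * U * B * C.transpose).trace| ≤ K * √K := by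
  have hK := (trace_mul_transpose_self_nonneg A).trans hA
  rw [← trace_mul_orthogonal_mul_transpose_self A U] at hA
  have hAB : (A * U * B * (A * (U : Matrix (Fin n) (Fin n) ℝ) * B).transpose).trace ≤ K * K :=
    (trace_mul_mul_transpose_self_le _ _).trans
      (mul_le_mul hA hB (trace_mul_transpose_self_nonneg B) hK)
  refine (abs_trace_mul_transpose_le hAB hC).trans_eq ?_
  rw [Real.sqrt_mul (mul_nonneg hK hK), Real.sqrt_mul_self hK]

theorem abs_trace_mul_orthogonal_mul_mul_le :
    |(A * U * (B * U) * (C * U)).trace| ≤ K * √K := by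
  have hK := (trace_mul_transpose_self_nonneg A).trans hA
  rw [← trace_mul_orthogonal_mul_transpose_self A U] at hA
  rw [← trace_mul_orthogonal_mul_transpose_self B U] at hB
  rw [← trace_mul_orthogonal_mul_transpose_self C U] at hC
  have hAB : (A * U * (B * U) * (A * (U : Matrix (Fin n) (Fin n) ℝ)
      * (B * (U : Matrix (Fin n) (Fin n) ℝ))).transpose).trace ≤ K * K :=
    (trace_mul_mul_transpose_self_le _ _).trans
      (mul_le_mul hA hB (trace_mul_transpose_self_nonneg _) hK)
  refine (abs_trace_mul_le hAB hC).trans_eq ?_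
  rw [Real.sqrt_mul (mul_nonneg hK hK), Real.sqrt_mul_self hK]

end FrobeniusBounds

section MomentBounds

theorem abs_prod_le_one_add_sum_pow {ι : Type*} (S : Finset ι) (x : ι → ℝ) :
    |∏ t ∈ S, x t| ≤ 1 + ∑ t ∈ S, x t ^ (2 * S.card) := by
  rcases S.eq_empty_or_nonempty with rfl | hS
  · simp
  obtain ⟨t, ht, hmax⟩ := S.exists_max_image (fun t => |x t|) hS
  have h1 : |∏ t ∈ S, x t| ≤ |x t| ^ S.card := by
    rw [Finset.abs_prod, ← Finset.prod_const]
    exact Finset.prod_le_prod (fun i _ => abs_nonneg _) hmax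
  have h2 : x t ^ (2 * S.card) ≤ ∑ t ∈ S, x t ^ (2 * S.card) :=
    Finset.single_le_sum (f := fun t => x t ^ (2 * S.card))
      (fun i _ => (even_two_mul _).pow_nonneg _) ht
  have h3 : x t ^ (2 * S.card) = (|x t| ^ S.card) ^ 2 := by
    rw [← pow_mul, mul_comm S.card, (even_two_mul _).pow_abs]
  nlinarith [sq_nonneg (|x t| ^ S.card - 1)]

theorem exists_bound_integral_trace_pow {L : ℝ} (hL : 0 ≤ L) (k : ℕ) :
    ∃ D : ℝ, 0 ≤ D ∧ ∀ (n : ℕ), 2 ≤ n → ∀ (μ : Measure (Matrix.orthogonalGroup (Fin n) ℝ))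
      [IsProbabilityMeasure μ] [μ.IsMulRightInvariant] (B : Matrix (Fin n) (Fin n) ℝ),
      (B * B.transpose).trace ≤ L * n →
        ∫ U : Matrix.orthogonalGroup (Fin n) ℝ, (B * U).trace ^ (2 * k) ∂μ ≤ D := by
  induction k with
  | zero => exact ⟨1, zero_le_one, fun n _ μ _ _ B _ => by simp⟩
  | succ k ih =>
    obtain ⟨D, hD0, hD⟩ := ih
    refine ⟨(2 * k + 1) * (4 * L) * D, by positivity, fun n hn μ _ _ B hB => ?_⟩
    have hn' : (2 : ℝ) ≤ n := by exact_mod_cast hn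
    have h := integral_trace_mul_prod μ (Finset.range (2 * k + 1)) (fun _ => B) B
    have hle : ∀ t ∈ Finset.range (2 * k + 1), ∫ U : Matrix.orthogonalGroup (Fin n) ℝ,
        ((B * B.transpose).trace - (B * U * (B * U)).trace)
          * ∏ u ∈ (Finset.range (2 * k + 1)).erase t, (B * U).trace ∂μ ≤ 2 * (L * n) * D := by
      intro t ht
      refine (integral_mono (g := fun U : Matrix.orthogonalGroup (Fin n) ℝ =>
        2 * (L * n) * (B * (U : Matrix (Fin n) (Fin n) ℝ)).trace ^ (2 * k))
        (Continuous.integrable_orthogonalGroup (by fun_prop))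
        (Continuous.integrable_orthogonalGroup (by fun_prop)) fun U => ?_).trans ?_
      · rw [Finset.prod_const, Finset.card_erase_of_mem ht, Finset.card_range,
          Nat.add_sub_cancel]
        refine mul_le_mul_of_nonneg_right ?_ ((even_two_mul _).pow_nonneg _)
        have := (abs_le.mp (abs_trace_mul_orthogonal_le hB hB U)).1
        linarith
      · rw [integral_const_mul]
        exact mul_le_mul_of_nonneg_left (hD n hn μ B hB) (by positivity)
    have hsum := Finset.sum_le_sum hle
    rw [← h] at hsum
    simp only [Finset.prod_const, Finset.card_range, Finset.sum_const, nsmul_eq_mul,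
      ← pow_succ'] at hsum
    rw [show 2 * (k + 1) = 2 * k + 1 + 1 by ring]
    have hpos : (0 : ℝ) < n - 1 := by linarith
    refine le_of_mul_le_mul_left (hsum.trans ?_) hpos
    push_cast
    have hfac : 0 ≤ (2 * (k : ℝ) + 1) * L * D := by positivity
    nlinarith

theorem exists_bound_integral_abs_prod_trace {L : ℝ} (hL : 0 ≤ L) (k : ℕ) :
    ∃ D : ℝ, 0 ≤ D ∧ ∀ (n : ℕ), 2 ≤ n → ∀ (μ : Measure (Matrix.orthogonalGroup (Fin n) ℝ))
      [IsProbabilityMeasure μ] [μ.IsMulRightInvariant] {ι : Type} (S : Finset ι)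
      (C : ι → Matrix (Fin n) (Fin n) ℝ), S.card = k →
      (∀ t, (C t * (C t).transpose).trace ≤ L * n) →
        ∫ U : Matrix.orthogonalGroup (Fin n) ℝ, |∏ t ∈ S, (C t * U).trace| ∂μ ≤ D := by
  obtain ⟨D, hD0, hD⟩ := exists_bound_integral_trace_pow hL k
  refine ⟨1 + k * D, by positivity, fun n hn μ _ _ ι S C hS hC => ?_⟩
  refine (integral_mono (g := fun U : Matrix.orthogonalGroup (Fin n) ℝ =>
    1 + ∑ t ∈ S, (C t * (U : Matrix (Fin n) (Fin n) ℝ)).trace ^ (2 * S.card))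
    (Continuous.integrable_orthogonalGroup (by fun_prop))
    (Continuous.integrable_orthogonalGroup (by fun_prop))
    fun U => abs_prod_le_one_add_sum_pow _ _).trans ?_
  rw [integral_add (integrable_const _) (Continuous.integrable_orthogonalGroup (by fun_prop)),
    integral_finsetSum _ fun t _ => Continuous.integrable_orthogonalGroup (by fun_prop), hS]
  have := Finset.sum_le_sum fun t (_ : t ∈ S) => hD n hn μ (C t) (hC t)
  rw [Finset.sum_const, hS, nsmul_eq_mul] at this
  simpa using this

theorem abs_integral_mul_le {n : ℕ} (μ : Measure (Matrix.orthogonalGroup (Fin n) ℝ))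
    [IsProbabilityMeasure μ] {f g : Matrix.orthogonalGroup (Fin n) ℝ → ℝ} {K D : ℝ}
    (hK : 0 ≤ K) (hf : Continuous f) (hg : Continuous g) (hfK : ∀ U, |f U| ≤ K)
    (hgD : ∫ U, |g U| ∂μ ≤ D) : |∫ U, f U * g U ∂μ| ≤ K * D := by
  refine (abs_integral_le_integral_abs).trans ?_
  refine (integral_mono (g := fun U => K * |g U|)
    (Continuous.integrable_orthogonalGroup (by fun_prop))
    (Continuous.integrable_orthogonalGroup (by fun_prop)) fun U => ?_).trans ?_
  · simp only [abs_mul]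
    exact mul_le_mul_of_nonneg_right (hfK U) (abs_nonneg _)
  · rw [integral_const_mul]
    exact mul_le_mul_of_nonneg_left hgD hK

theorem exists_bound_integral_trace_mul_mul_mul_prod {L : ℝ} (hL : 0 ≤ L) (k : ℕ) :
    ∃ D : ℝ, 0 ≤ D ∧ ∀ (n : ℕ), 2 ≤ n → ∀ (μ : Measure (Matrix.orthogonalGroup (Fin n) ℝ))
      [IsProbabilityMeasure μ] [μ.IsMulRightInvariant] {ι : Type} [DecidableEq ι] (S : Finset ι)
      (C : ι → Matrix (Fin n) (Fin n) ℝ), S.card = k →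
      (∀ t, (C t * (C t).transpose).trace ≤ L * n) → ∀ a b, a ∉ S → b ∉ S → a ≠ b →
        |∫ U : Matrix.orthogonalGroup (Fin n) ℝ,
          (C a * U * (C b * U)).trace * ∏ t ∈ S, (C t * U).trace ∂μ| ≤ D * √n := by
  obtain ⟨D₀, hD₀, h0⟩ := exists_bound_integral_abs_prod_trace hL k
  obtain ⟨D₁, hD₁, h1⟩ := exists_bound_integral_abs_prod_trace hL (k - 1)
  obtain ⟨D₂, hD₂, h2⟩ := exists_bound_integral_abs_prod_trace hL (k + 2)
  refine ⟨2 * (L * D₀ + D₂ + k * (2 * (L * √L) * D₁)), by positivity,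
    fun n hn μ _ _ ι _ S C hS hC a b ha hb hab => ?_⟩
  have hn' : (2 : ℝ) ≤ n := by exact_mod_cast hn
  have h := integral_trace_mul_mul_mul_prod μ S C (C a) (C b)
  set I := ∫ U : Matrix.orthogonalGroup (Fin n) ℝ,
          (C a * U * (C b * U)).trace * ∏ t ∈ S, (C t * U).trace ∂μ with hI
  have hfirst : |∫ U : Matrix.orthogonalGroup (Fin n) ℝ,
      ((C a * (C b).transpose).trace - (C a * U).trace * (C b * U).trace)
        * ∏ t ∈ S, (C t * U).trace ∂μ| ≤ L * n * D₀ + D₂ := by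
    simp only [sub_mul]
    rw [integral_sub (Continuous.integrable_orthogonalGroup (by fun_prop))
      (Continuous.integrable_orthogonalGroup (by fun_prop))]
    refine (abs_sub _ _).trans (add_le_add ?_ ?_)
    · exact abs_integral_mul_le μ (by positivity) (by fun_prop) (by fun_prop)
        (fun _ => abs_trace_mul_transpose_le_self (hC a) (hC b)) (h0 n hn μ S C hS hC)
    · refine (abs_integral_le_integral_abs).trans (le_trans (le_of_eq ?_)
        (h2 n hn μ (insert a (insert b S)) C ?_ hC))
      · congr 1
        ext U
        rw [Finset.prod_insert (by simp [hab, ha]), Finset.prod_insert hb, mul_assoc]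
      · rw [Finset.card_insert_of_notMem (by simp [hab, ha]), Finset.card_insert_of_notMem hb, hS]
  have hsecond : ∀ t ∈ S, |∫ U : Matrix.orthogonalGroup (Fin n) ℝ,
      ((C a * U * C b * (C t).transpose).trace - (C a * U * (C b * U) * (C t * U)).trace)
        * ∏ u ∈ S.erase t, (C u * U).trace ∂μ| ≤ 2 * (L * n * √(L * n)) * D₁ := by
    intro t ht
    refine abs_integral_mul_le μ (by positivity) (by fun_prop) (by fun_prop) (fun U => ?_)
      (h1 n hn μ (S.erase t) C (by rw [Finset.card_erase_of_mem ht, hS]) hC)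
    refine (abs_sub _ _).trans ?_
    rw [two_mul]
    exact add_le_add (abs_trace_mul_orthogonal_mul_transpose_le (hC a) (hC b) (hC t) U)
      (abs_trace_mul_orthogonal_mul_mul_le (hC a) (hC b) (hC t) U)
  have hsum := (Finset.abs_sum_le_sum_abs _ _).trans (Finset.sum_le_sum hsecond)
  rw [Finset.sum_const, hS, nsmul_eq_mul] at hsum
  have htot : ((n : ℝ) - 1) * |I|
      ≤ L * n * D₀ + D₂ + k * (2 * (L * n * √(L * n)) * D₁) := by
    rw [← abs_of_nonneg (show (0 : ℝ) ≤ n - 1 by linarith), ← abs_mul, h]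
    exact (abs_add_le _ _).trans (add_le_add hfirst hsum)
  rw [Real.sqrt_mul hL] at htot
  have hs : 1 ≤ √(n : ℝ) := Real.one_le_sqrt.mpr (by linarith)
  have e1 : L * n * D₀ ≤ n * √n * (L * D₀) := by
    have : 0 ≤ n * (L * D₀) * (√n - 1) := mul_nonneg (by positivity) (by linarith)
    linarith
  have e2 : D₂ ≤ n * √n * D₂ :=
    le_mul_of_one_le_left hD₂ (one_le_mul_of_one_le_of_one_le (by linarith) hs)
  have e3 : (n : ℝ) * |I| ≤ 2 * (((n : ℝ) - 1) * |I|) := by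
    nlinarith [abs_nonneg I]
  refine le_of_mul_le_mul_left (e3.trans ?_) (show (0 : ℝ) < n by linarith)
  linarith

end MomentBounds

section Wick

variable {m : ℕ}

/-- Involutions whose set of non-fixed points is `S`, i.e. pair partitions of `S`. -/
def pairings (S : Finset (Fin m)) : Finset (Equiv.Perm (Fin m)) :=
  Finset.univ.filter fun p => p * p = 1 ∧ ∀ a, p a ≠ a ↔ a ∈ S

theorem mem_pairings {S : Finset (Fin m)} {p : Equiv.Perm (Fin m)} :
    p ∈ pairings S ↔ (∀ a, p (p a) = a) ∧ ∀ a, p a ≠ a ↔ a ∈ S := by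
  simp [pairings, Equiv.ext_iff]

/-- The Wick sum over the pair partitions of `S`. -/
noncomputable def wickSum (c : Fin m → Fin m → ℝ) (S : Finset (Fin m)) : ℝ :=
  ∑ p ∈ pairings S, ∏ a ∈ Finset.univ.filter fun a : Fin m => a < p a, c a (p a)

theorem wickSum_empty (c : Fin m → Fin m → ℝ) : wickSum c ∅ = 1 := by
  have h : pairings (∅ : Finset (Fin m)) = {1} := by
    ext p
    simp only [mem_pairings, Finset.notMem_empty, iff_false, not_not, Finset.mem_singleton,
      Equiv.ext_iff, Equiv.Perm.one_apply]
    exact ⟨fun h => h.2, fun h => ⟨fun a => by rw [h, h], h⟩⟩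
  simp [wickSum, h]

theorem swap_mul_mem_pairings_erase {S : Finset (Fin m)} {p : Equiv.Perm (Fin m)} {i j : Fin m}
    (hp : p ∈ pairings S) (hij : p i = j) :
    Equiv.swap i j * p ∈ pairings ((S.erase i).erase j) := by
  rw [mem_pairings] at hp ⊢
  obtain ⟨hinv, hS⟩ := hp
  have hji : p j = i := by rw [← hij, hinv]
  have hi : (Equiv.swap i j * p) i = i := by simp [hij]
  have hj : (Equiv.swap i j * p) j = j := by simp [hji]
  have hx : ∀ x, x ≠ i → x ≠ j → (Equiv.swap i j * p) x = p x := fun x h1 h2 =>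
    Equiv.swap_apply_of_ne_of_ne (fun h => h2 (p.injective (h.trans hji.symm)))
      (fun h => h1 (p.injective (h.trans hij.symm)))
  refine ⟨fun x => ?_, fun x => ?_⟩
  · by_cases h1 : x = i
    · rw [h1, hi, hi]
    by_cases h2 : x = j
    · rw [h2, hj, hj]
    rw [hx x h1 h2, hx, hinv]
    · exact fun h => h2 (p.injective (h.trans hji.symm))
    · exact fun h => h1 (p.injective (h.trans hij.symm))
  · by_cases h1 : x = i
    · simp [h1, hij]
    by_cases h2 : x = j
    · simp [h2, hji]
    rw [hx x h1 h2, hS]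
    simp [h1, h2]

theorem swap_mul_mem_pairings {S : Finset (Fin m)} {q : Equiv.Perm (Fin m)} {i j : Fin m}
    (hi : i ∈ S) (hj : j ∈ S) (hij : i ≠ j) (hq : q ∈ pairings ((S.erase i).erase j)) :
    Equiv.swap i j * q ∈ pairings S ∧ (Equiv.swap i j * q) i = j ∧
      ∀ x, x ≠ i → x ≠ j → (Equiv.swap i j * q) x = q x := by
  rw [mem_pairings] at hq ⊢
  obtain ⟨hinv, hS⟩ := hq
  have hqi : q i = i := by by_contra h; simpa using (hS i).mp h
  have hqj : q j = j := by by_contra h; simpa using (hS j).mp h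
  have hpi : (Equiv.swap i j * q) i = j := by simp [hqi]
  have hpj : (Equiv.swap i j * q) j = i := by simp [hqj]
  have hne : ∀ x, x ≠ i → x ≠ j → q x ≠ i ∧ q x ≠ j := fun x h1 h2 =>
    ⟨fun h => h1 (q.injective (h.trans hqi.symm)), fun h => h2 (q.injective (h.trans hqj.symm))⟩
  have hx : ∀ x, x ≠ i → x ≠ j → (Equiv.swap i j * q) x = q x := fun x h1 h2 =>
    Equiv.swap_apply_of_ne_of_ne (hne x h1 h2).1 (hne x h1 h2).2
  refine ⟨⟨fun x => ?_, fun x => ?_⟩, hpi, hx⟩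
  · by_cases h1 : x = i
    · rw [h1, hpi, hpj]
    by_cases h2 : x = j
    · rw [h2, hpj, hpi]
    rw [hx x h1 h2, hx _ (hne x h1 h2).1 (hne x h1 h2).2, hinv]
  · by_cases h1 : x = i
    · rw [h1, hpi]
      exact iff_of_true hij.symm hi
    by_cases h2 : x = j
    · rw [h2, hpj]
      exact iff_of_true hij hj
    rw [hx x h1 h2, hS]
    simp [h1, h2]

theorem wickSum_eq_sum_erase (c : Fin m → Fin m → ℝ) {S : Finset (Fin m)} {i : Fin m} (hi : i ∈ S)
    (hmin : ∀ j ∈ S, i ≤ j) :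
    wickSum c S = ∑ j ∈ S.erase i, c i j * wickSum c ((S.erase i).erase j) := by
  have hmaps : ∀ p ∈ pairings S, p i ∈ S.erase i := by
    intro p hp
    rw [mem_pairings] at hp
    have h := (hp.2 i).mpr hi
    refine Finset.mem_erase.mpr ⟨h, (hp.2 _).mp ?_⟩
    rw [hp.1]
    exact h.symm
  rw [wickSum, ← Finset.sum_fiberwise_of_maps_to hmaps]
  refine Finset.sum_congr rfl fun j hj => ?_
  obtain ⟨hji, hjS⟩ := Finset.mem_erase.mp hj
  rw [wickSum, Finset.mul_sum]
  refine Finset.sum_nbij' (fun p => Equiv.swap i j * p) (fun q => Equiv.swap i j * q)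
    ?_ ?_ ?_ ?_ ?_
  · intro p hp
    rw [Finset.mem_filter] at hp
    exact swap_mul_mem_pairings_erase hp.1 hp.2
  · intro q hq
    have h := swap_mul_mem_pairings hi hjS hji.symm hq
    exact Finset.mem_filter.mpr ⟨h.1, h.2.1⟩
  · intro p _
    simp
  · intro q _
    simp
  · intro p hp
    rw [Finset.mem_filter] at hp
    have hq := swap_mul_mem_pairings_erase hp.1 hp.2
    have hback := (swap_mul_mem_pairings hi hjS hji.symm hq).2.2
    rw [Equiv.swap_mul_self_mul] at hback
    set q := Equiv.swap i j * p with hqdef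
    have hqS := (mem_pairings.mp hq).2
    have hqi : q i = i := by by_contra h; simpa using (hqS i).mp h
    have hqj : q j = j := by by_contra h; simpa using (hqS j).mp h
    have hpj : p j = i := by rw [← hp.2, (mem_pairings.mp hp.1).1]
    have hlt : i < j := lt_of_le_of_ne (hmin j hjS) hji.symm
    have hfilter : (Finset.univ.filter fun a : Fin m => a < p a)
        = insert i (Finset.univ.filter fun a : Fin m => a < q a) := by
      ext a
      simp only [Finset.mem_filter, Finset.mem_univ, true_and, Finset.mem_insert]
      by_cases h1 : a = i
      · simp [h1, hp.2, hlt]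
      by_cases h2 : a = j
      · simp [h2, hpj, hqj, hlt.le, hji]
      simp [h1, hback a h1 h2]
    rw [hfilter, Finset.prod_insert (by simp [hqi]), hp.2]
    congr 1
    refine Finset.prod_congr rfl fun a ha => ?_
    rw [Finset.mem_filter] at ha
    rw [hback a (fun h => by simp [h, hqi] at ha) (fun h => by simp [h, hqj] at ha)]

end Wick

theorem tendsto_integral_prod_trace {m : ℕ} (c : Fin m → Fin m → ℝ)
    (B : ∀ n : ℕ, Fin m → Matrix (Fin n) (Fin n) ℝ)
    (hconv : ∀ i j, Tendsto (fun n : ℕ => (n : ℝ)⁻¹ * (B n i * (B n j).transpose).trace)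
      atTop (nhds (c i j)))
    (μ : ∀ n : ℕ, Measure (Matrix.orthogonalGroup (Fin n) ℝ))
    [∀ n, IsProbabilityMeasure (μ n)] [∀ n, (μ n).IsMulRightInvariant] (S : Finset (Fin m)) :
    Tendsto (fun n : ℕ => ∫ U : Matrix.orthogonalGroup (Fin n) ℝ,
      ∏ t ∈ S, (B n t * U).trace ∂(μ n)) atTop (nhds (wickSum c S)) := by
  obtain ⟨L, hL, hBL⟩ : ∃ L : ℝ, 0 ≤ L ∧ ∀ᶠ n : ℕ in atTop,
      ∀ t, (B n t * (B n t).transpose).trace ≤ L * n := by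
    refine ⟨∑ t, (|c t t| + 1), by positivity, eventually_all.mpr fun t => ?_⟩
    have hlt : c t t < ∑ t, (|c t t| + 1) :=
      lt_of_lt_of_le (by linarith [le_abs_self (c t t)])
        (Finset.single_le_sum (f := fun t => |c t t| + 1) (fun i _ => by positivity)
          (Finset.mem_univ t))
    filter_upwards [(hconv t t).eventually_lt_const hlt, eventually_gt_atTop 0] with n hn hn0
    have hn0' : (0 : ℝ) < n := by exact_mod_cast hn0
    rw [inv_mul_lt_iff₀ hn0'] at hn
    linarith
  have hratio : Tendsto (fun n : ℕ => (n : ℝ) / ((n : ℝ) - 1)) atTop (nhds 1) := by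
    have h := tendsto_natCast_div_add_atTop (-1 : ℝ)
    simpa [sub_eq_add_neg] using h
  have hsqrt : Tendsto (fun n : ℕ => √(n : ℝ) / ((n : ℝ) - 1)) atTop (nhds 0) := by
    have h : Tendsto (fun n : ℕ => (√(n : ℝ))⁻¹) atTop (nhds 0) :=
      tendsto_inv_atTop_zero.comp (Real.tendsto_sqrt_atTop.comp tendsto_natCast_atTop_atTop)
    have h2 := h.mul hratio
    rw [zero_mul] at h2
    refine h2.congr' ?_
    filter_upwards [eventually_gt_atTop 0] with n hn
    have hn0 : (0 : ℝ) < n := by exact_mod_cast hn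
    rw [← mul_div_assoc, inv_mul_eq_div, Real.div_sqrt]
  induction S using Finset.strongInduction with
  | H S ih =>
    rcases S.eq_empty_or_nonempty with rfl | hS
    · simp [wickSum_empty]
    set i := S.min' hS
    have hi : i ∈ S := S.min'_mem hS
    rw [wickSum_eq_sum_erase c hi fun j hj => S.min'_le j hj]
    obtain ⟨D, hD, herr⟩ :=
      exists_bound_integral_trace_mul_mul_mul_prod hL ((S.erase i).card - 1)
    have hterm : ∀ j ∈ S.erase i, Tendsto (fun n : ℕ =>
        (n : ℝ) / ((n : ℝ) - 1) * ((n : ℝ)⁻¹ * (B n i * (B n j).transpose).trace)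
          * (∫ U : Matrix.orthogonalGroup (Fin n) ℝ,
              ∏ t ∈ (S.erase i).erase j, (B n t * U).trace ∂(μ n))
          - ((n : ℝ) - 1)⁻¹ * ∫ U : Matrix.orthogonalGroup (Fin n) ℝ,
              (B n i * U * (B n j * U)).trace
                * ∏ t ∈ (S.erase i).erase j, (B n t * U).trace ∂(μ n))
        atTop (nhds (c i j * wickSum c ((S.erase i).erase j))) := by
      intro j hj
      have hsub : (S.erase i).erase j ⊂ S :=
        (Finset.erase_ssubset hj).trans (Finset.erase_ssubset hi)
      have hmain := (hratio.mul (hconv i j)).mul (ih _ hsub)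
      have hzero : Tendsto (fun n : ℕ => ((n : ℝ) - 1)⁻¹ *
          ∫ U : Matrix.orthogonalGroup (Fin n) ℝ, (B n i * U * (B n j * U)).trace
            * ∏ t ∈ (S.erase i).erase j, (B n t * U).trace ∂(μ n)) atTop (nhds 0) := by
        have hD0 := hsqrt.const_mul D
        rw [mul_zero] at hD0
        refine squeeze_zero_norm' ?_ hD0
        filter_upwards [hBL, eventually_ge_atTop 2] with n hn hn2
        have hn2' : (2 : ℝ) ≤ n := by exact_mod_cast hn2
        have hpos : (0 : ℝ) < n - 1 := by linarith
        have := herr n hn2 (μ n) ((S.erase i).erase j) (B n) (Finset.card_erase_of_mem hj) hn i j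
          (by simp) (by simp) (Finset.ne_of_mem_erase hj).symm
        rw [Real.norm_eq_abs, abs_mul, abs_of_pos (inv_pos.mpr hpos), ← mul_div_assoc,
          inv_mul_eq_div]
        exact div_le_div_of_nonneg_right this hpos.le
      simpa using hmain.sub hzero
    refine (tendsto_finsetSum _ hterm).congr' ?_
    filter_upwards [eventually_ge_atTop 2] with n hn2
    have hn2' : (2 : ℝ) ≤ n := by exact_mod_cast hn2
    have hpos : (0 : ℝ) < n - 1 := by linarith
    have hrec := integral_trace_mul_prod (μ n) (S.erase i) (B n) (B n i)
    have hprod : ∀ U : Matrix.orthogonalGroup (Fin n) ℝ,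
        (B n i * (U : Matrix (Fin n) (Fin n) ℝ)).trace * ∏ t ∈ S.erase i, (B n t * U).trace
          = ∏ t ∈ S, (B n t * U).trace := fun U =>
      Finset.mul_prod_erase S (fun t => (B n t * (U : Matrix (Fin n) (Fin n) ℝ)).trace) hi
    simp only [hprod] at hrec
    rw [(eq_inv_mul_iff_mul_eq₀ hpos.ne').mpr hrec, Finset.mul_sum]
    refine Finset.sum_congr rfl fun j _ => ?_
    simp only [sub_mul]
    rw [integral_sub (Continuous.integrable_orthogonalGroup (by fun_prop))
      (Continuous.integrable_orthogonalGroup (by fun_prop)), integral_const_mul]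
    field_simp

/-- Diaconis–Shahshahani / Borel-type central limit theorem for the orthogonal group:
if `A_i^{(n)} ∈ M_n(ℝ)` satisfy `(1/n)Tr(A_i^{(n)} (A_j^{(n)})ᵗ) → A_{ij}` with `A`
symmetric, and `U` is Haar distributed on `O(n)`, then the vector
`(Tr(A_1^{(n)}U), …, Tr(A_r^{(n)}U))` converges in moments to a centered Gaussian
vector of covariance `A`; the limiting mixed moments are the Wick sums
`Σ_p ∏_{{a,b}∈p} A_{s(a)s(b)}` over pair partitions `p` (here encoded as
fixed-point-free involutions, each block counted once via `a < p a`). -/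
theorem stmt18 (r : ℕ) (hr : 1 ≤ r)
    (A : Matrix (Fin r) (Fin r) ℝ) (hA : A.IsSymm)
    (Amat : ∀ n : ℕ, Fin r → Matrix (Fin n) (Fin n) ℝ)
    (hconv : ∀ i j : Fin r,
      Tendsto (fun n : ℕ => (n : ℝ)⁻¹ * Matrix.trace (Amat n i * (Amat n j).transpose))
        atTop (nhds (A i j)))
    (μ : ∀ n : ℕ, Measure (Matrix.orthogonalGroup (Fin n) ℝ))
    (hHaar : ∀ n : ℕ, (μ n).IsHaarMeasure)
    (hright : ∀ n : ℕ, (μ n).IsMulRightInvariant)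
    (hprob : ∀ n : ℕ, IsProbabilityMeasure (μ n)) :
    ∀ m : ℕ, 1 ≤ m → ∀ s : Fin m → Fin r,
      Tendsto
        (fun n : ℕ => ∫ U : Matrix.orthogonalGroup (Fin n) ℝ,
          ∏ t : Fin m,
            Matrix.trace (Amat n (s t) * (U : Matrix (Fin n) (Fin n) ℝ)) ∂(μ n))
        atTop
        (nhds (∑ p ∈ Finset.univ.filter
            (fun p : Equiv.Perm (Fin m) => p * p = 1 ∧ ∀ a : Fin m, p a ≠ a),
          ∏ a ∈ Finset.univ.filter fun a : Fin m => a < p a, A (s a) (s (p a)))) := by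
  intro m _ s
  have := tendsto_integral_prod_trace (fun a b => A (s a) (s b)) (fun n t => Amat n (s t))
    (fun i j => hconv (s i) (s j)) μ Finset.univ
  simpa [wickSum, pairings] using this
end
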